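/- arXiv:1507.03241 — 2 statements merged into one kernel-verified Lean document; each statement's English description precedes it below -/
import Mathlib

section
/- Let 1 < p < 2 and p < q < ∞, and let X be a real Banach space that contains a complemented copy of ℓ_p and contains an isomorphic copy of either ℓ_q or c₀. Then there exists a family (𝔍_r)_{r ∈ (0,1)} of closed ideals of L(X), each contained in the set of finitely strictly singular operators on X, such that 𝔍_r ⊊ 𝔍_s whenever 0 < r < s < 1; in particular, L(X) admits a chain, with cardinality of the continuum, of closed ideals consisting of finitely strictly singular operators. -/
open scoped ENNReal

noncomputable section

/-- An operator `T` is finitely strictly singular if for every `ε > 0` there is `n`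
such that every `n`-dimensional subspace contains a nonzero vector `x` with
`‖T x‖ < ε * ‖x‖`. -/
def FinStrictSing {𝕜 X Y : Type*} [NontriviallyNormedField 𝕜]
    [NormedAddCommGroup X] [NormedSpace 𝕜 X] [NormedAddCommGroup Y] [NormedSpace 𝕜 Y]
    (T : X →L[𝕜] Y) : Prop :=
  ∀ ε : ℝ, 0 < ε → ∃ n : ℕ, ∀ E : Submodule 𝕜 X, Module.finrank 𝕜 E = n →
    ∃ x ∈ E, x ≠ 0 ∧ ‖T x‖ < ε * ‖x‖

/-! ### Three-valued random variables -/

/-- weights of the three-valued variable -/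
def wt3 (μ : ℝ) : Fin 3 → ℝ := ![μ / 2, 1 - μ, μ / 2]

/-- values of the three-valued variable -/
def vl3 : Fin 3 → ℝ := ![-1, 0, 1]

/-- product weight -/
def wtProd (μ : ℝ) {n : ℕ} (ω : Fin n → Fin 3) : ℝ := ∏ j, wt3 μ (ω j)

lemma wt3_nonneg {μ : ℝ} (h0 : 0 ≤ μ) (h1 : μ ≤ 1) (s : Fin 3) : 0 ≤ wt3 μ s := by
  fin_cases s <;> simp [wt3] <;> linarith

lemma wtProd_nonneg {μ : ℝ} (h0 : 0 ≤ μ) (h1 : μ ≤ 1) {n : ℕ} (ω : Fin n → Fin 3) :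
    0 ≤ wtProd μ ω := Finset.prod_nonneg fun _ _ => wt3_nonneg h0 h1 _

lemma sum_wtProd_mul_prod (μ : ℝ) {n : ℕ} (h : Fin n → Fin 3 → ℝ) :
    ∑ ω : Fin n → Fin 3, wtProd μ ω * ∏ j, h j (ω j) = ∏ j, ∑ s, wt3 μ s * h j s := by
  rw [Finset.prod_univ_sum]
  simp [wtProd, Finset.prod_mul_distrib]

lemma sum_wtProd (μ : ℝ) (n : ℕ) : ∑ ω : Fin n → Fin 3, wtProd μ ω = 1 := by
  have := sum_wtProd_mul_prod μ (n := n) (fun _ _ => 1)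
  simp only [Finset.prod_const_one, mul_one] at this
  rw [this]
  apply Finset.prod_eq_one
  intro j _
  simp [Fin.sum_univ_three, wt3]; ring

lemma sum_wtProd_sq (μ : ℝ) {n : ℕ} (i : Fin n) :
    ∑ ω : Fin n → Fin 3, wtProd μ ω * (vl3 (ω i)) ^ 2 = μ := by
  have := sum_wtProd_mul_prod μ (n := n) (fun j s => if j = i then (vl3 s) ^ 2 else 1)
  have h2 : ∀ ω : Fin n → Fin 3, (∏ j, if j = i then (vl3 (ω j)) ^ 2 else 1) = (vl3 (ω i)) ^ 2 := by
    intro ω; simp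
  simp only [h2] at this
  rw [this, Finset.prod_eq_single i]
  · simp [Fin.sum_univ_three, wt3, vl3]
  · intro j _ hj
    simp [hj, Fin.sum_univ_three, wt3]; ring
  · simp

/-- the random sum -/
def rsum {n : ℕ} (D : Finset (Fin n)) (σ : Fin n → ℝ) (ω : Fin n → Fin 3) : ℝ :=
  ∑ j ∈ D, σ j * vl3 (ω j)

lemma mgf_rsum (μ : ℝ) {n : ℕ} (D : Finset (Fin n)) (σ : Fin n → ℝ)
    (hσ : ∀ i, σ i = 1 ∨ σ i = -1) (t : ℝ) :
    ∑ ω, wtProd μ ω * Real.exp (t * rsum D σ ω) = (1 + μ * (Real.cosh t - 1)) ^ D.card := by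
  have h1 : ∀ ω : Fin n → Fin 3, Real.exp (t * rsum D σ ω) =
      ∏ j, (if j ∈ D then Real.exp (t * (σ j * vl3 (ω j))) else 1) := by
    intro ω
    rw [rsum, Finset.mul_sum, Real.exp_sum, Finset.prod_ite_mem, Finset.univ_inter]
  simp only [h1]
  rw [sum_wtProd_mul_prod μ (fun j s => if j ∈ D then Real.exp (t * (σ j * vl3 s)) else 1)]
  have h2 : ∀ j, (∑ s, wt3 μ s * (if j ∈ D then Real.exp (t * (σ j * vl3 s)) else 1)) =
      if j ∈ D then (1 + μ * (Real.cosh t - 1)) else 1 := by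
    intro j
    split_ifs with hj
    · rcases hσ j with h | h <;>
      · simp [Fin.sum_univ_three, wt3, vl3, h, Real.cosh_eq]; ring
    · simp [Fin.sum_univ_three, wt3]; ring
  simp only [h2]
  rw [Finset.prod_ite_mem, Finset.univ_inter, Finset.prod_const]

lemma cosh_rsum (μ : ℝ) {n : ℕ} (D : Finset (Fin n)) (σ : Fin n → ℝ)
    (hσ : ∀ i, σ i = 1 ∨ σ i = -1) (t : ℝ) :
    ∑ ω, wtProd μ ω * Real.cosh (t * rsum D σ ω) = (1 + μ * (Real.cosh t - 1)) ^ D.card := by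
  have h1 := mgf_rsum μ D σ hσ t
  have h2 := mgf_rsum μ D σ hσ (-t)
  rw [Real.cosh_neg] at h2
  have : ∀ ω, wtProd μ ω * Real.cosh (t * rsum D σ ω) =
    (wtProd μ ω * Real.exp (t * rsum D σ ω) + wtProd μ ω * Real.exp (-t * rsum D σ ω)) / 2 := by
    intro ω; rw [Real.cosh_eq, neg_mul]; ring
  simp only [this]
  rw [← Finset.sum_div, Finset.sum_add_distrib, h1, h2]; ring

lemma cosh_rsum_le {μ : ℝ} (h0 : 0 ≤ μ) {n : ℕ} (D : Finset (Fin n)) (σ : Fin n → ℝ)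
    (hσ : ∀ i, σ i = 1 ∨ σ i = -1) (t : ℝ) :
    ∑ ω, wtProd μ ω * Real.cosh (t * rsum D σ ω) ≤
      Real.exp (D.card * μ * (Real.cosh t - 1)) := by
  rw [cosh_rsum μ D σ hσ t]
  have h1 : 0 ≤ μ * (Real.cosh t - 1) := mul_nonneg h0 (by linarith [Real.one_le_cosh t])
  calc (1 + μ * (Real.cosh t - 1)) ^ D.card ≤ (Real.exp (μ * (Real.cosh t - 1))) ^ D.card := by
        gcongr
        linarith [Real.add_one_le_exp (μ * (Real.cosh t - 1))]
    _ = _ := by rw [← Real.exp_nat_mul]; ring_nf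

lemma rpow_le_cosh (r : ℝ) (hr : 0 < r) : ∃ C : ℝ, 0 < C ∧ ∀ x : ℝ, |x| ^ r ≤ C * Real.cosh x := by
  obtain ⟨m, hm⟩ := exists_nat_ge r
  refine ⟨1 + 2 * m.factorial, by positivity, fun x => ?_⟩
  have h1 := Real.one_le_cosh x
  have h2 : Real.exp |x| ≤ 2 * Real.cosh x := by
    rw [← Real.cosh_abs, Real.cosh_eq]; linarith [Real.exp_pos (-|x|)]
  have h3 := Real.pow_div_factorial_le_exp |x| (abs_nonneg x) m
  rw [div_le_iff₀ (by positivity)] at h3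
  have hf : (0:ℝ) < m.factorial := by positivity
  rcases le_total |x| 1 with h | h
  · have : |x| ^ r ≤ 1 := Real.rpow_le_one (abs_nonneg x) h hr.le
    nlinarith
  · have : |x| ^ r ≤ |x| ^ m := by
      rw [← Real.rpow_natCast]; exact Real.rpow_le_rpow_of_exponent_le h hm
    nlinarith

lemma rsum_int {n : ℕ} (D : Finset (Fin n)) (σ : Fin n → ℝ)
    (hσ : ∀ i, σ i = 1 ∨ σ i = -1) (ω : Fin n → Fin 3) : ∃ z : ℤ, rsum D σ ω = z := by
  have h : ∀ j, ∃ z : ℤ, σ j * vl3 (ω j) = z := by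
    intro j
    have : vl3 (ω j) = 0 ∨ vl3 (ω j) = 1 ∨ vl3 (ω j) = -1 := by
      generalize ω j = s
      fin_cases s <;> simp [vl3]
    rcases hσ j with h | h <;> rcases this with h' | h' | h' <;> rw [h, h']
    · exact ⟨0, by simp⟩
    · exact ⟨1, by simp⟩
    · exact ⟨-1, by simp⟩
    · exact ⟨0, by simp⟩
    · exact ⟨-1, by simp⟩
    · exact ⟨1, by simp⟩
  choose z hz using h
  exact ⟨∑ j ∈ D, z j, by simp [rsum, hz]⟩

lemma cosh_sub_one_le {t : ℝ} (ht : |t| ≤ 1) : Real.cosh t - 1 ≤ t ^ 2 := by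
  have h1 := Real.cosh_le_exp_half_sq t
  have h2 : t ^ 2 ≤ 1 := by rw [← sq_abs]; nlinarith [abs_nonneg t]
  have h3 := Real.abs_exp_sub_one_le (x := t ^ 2 / 2) (by rw [abs_of_nonneg (by positivity)]; linarith)
  rw [abs_of_nonneg (a := t ^ 2 / 2) (by positivity)] at h3
  linarith [le_abs_self (Real.exp (t ^ 2 / 2) - 1)]

/-- moments of the random sums -/
lemma moment_rsum (r : ℝ) (hr : 0 < r) : ∃ C : ℝ, 0 < C ∧ ∀ (μ : ℝ), 0 ≤ μ → μ ≤ 1 →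
    ∀ (n : ℕ) (D : Finset (Fin n)) (σ : Fin n → ℝ), (∀ i, σ i = 1 ∨ σ i = -1) →
    ((D.card * μ ≤ 1 → ∑ ω, wtProd μ ω * |rsum D σ ω| ^ r ≤ C * (D.card * μ)) ∧
    (1 ≤ D.card * μ → ∑ ω, wtProd μ ω * |rsum D σ ω| ^ r ≤ C * (D.card * μ) ^ (r / 2))) := by
  obtain ⟨C, hC, hCx⟩ := rpow_le_cosh r hr
  refine ⟨6 * C, by positivity, fun μ h0 h1 n D σ hσ => ⟨fun hl => ?_, fun hl => ?_⟩⟩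
  · have key : ∀ ω, |rsum D σ ω| ^ r ≤ 3 * C * (Real.cosh (1 * rsum D σ ω) - 1) := by
      intro ω
      obtain ⟨z, hz⟩ := rsum_int D σ hσ ω
      rw [hz, one_mul]
      by_cases h : z = 0
      · simp [h, Real.zero_rpow hr.ne']
      · have h2 : (1:ℝ) ≤ |(z:ℝ)| := by exact_mod_cast Int.one_le_abs h
        have h3 : Real.cosh 1 ≤ Real.cosh z := by
          rw [Real.cosh_le_cosh]; simpa using h2
        have h4 : (3/2 : ℝ) ≤ Real.cosh 1 := by
          rw [Real.cosh_eq, Real.exp_neg]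
          have h5 : (2.7 : ℝ) < Real.exp 1 := lt_trans (by norm_num) Real.exp_one_gt_d9
          have h6 : Real.exp 1 < (2.8 : ℝ) := lt_trans Real.exp_one_lt_d9 (by norm_num)
          have : (1/2.8 : ℝ) ≤ (Real.exp 1)⁻¹ := by
            rw [one_div]; exact inv_anti₀ (by positivity) h6.le
          norm_num at this ⊢; linarith
        have := hCx z
        nlinarith
    have hb := cosh_rsum_le h0 D σ hσ 1
    set l := D.card * μ with hl'
    have hl0 : 0 ≤ l := by positivity
    have hc : Real.cosh 1 - 1 ≤ 1 := by simpa using cosh_sub_one_le (t := 1) (by simp)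
    have he : Real.exp (l * (Real.cosh 1 - 1)) ≤ 1 + 2 * l := by
      have h3 := Real.abs_exp_sub_one_le (x := l) (by rw [abs_of_nonneg hl0]; exact hl)
      rw [abs_of_nonneg hl0] at h3
      have : Real.exp (l * (Real.cosh 1 - 1)) ≤ Real.exp l := Real.exp_le_exp.2 (by nlinarith)
      linarith [le_abs_self (Real.exp l - 1)]
    calc ∑ ω, wtProd μ ω * |rsum D σ ω| ^ r
        ≤ ∑ ω, wtProd μ ω * (3 * C * (Real.cosh (1 * rsum D σ ω) - 1)) :=
          Finset.sum_le_sum fun ω _ => mul_le_mul_of_nonneg_left (key ω) (wtProd_nonneg h0 h1 ω)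
      _ = 3 * C * (∑ ω, wtProd μ ω * Real.cosh (1 * rsum D σ ω) - ∑ ω : Fin n → Fin 3, wtProd μ ω) := by
          rw [← Finset.sum_sub_distrib, Finset.mul_sum]
          exact Finset.sum_congr rfl fun ω _ => by ring
      _ ≤ 3 * C * (2 * l) := by
          rw [sum_wtProd]; gcongr; linarith
      _ = _ := by ring
  · set l := D.card * μ with hl'
    have hl0 : 0 < l := by linarith
    set t := (Real.sqrt l)⁻¹ with ht
    have hs : 1 ≤ Real.sqrt l := Real.one_le_sqrt.2 hl
    have hs0 : 0 < Real.sqrt l := by linarith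
    have ht0 : 0 < t := by positivity
    have hsr : Real.sqrt l ^ r = l ^ (r / 2) := by
      rw [Real.sqrt_eq_rpow, ← Real.rpow_mul hl0.le]; ring_nf
    have key : ∀ ω, |rsum D σ ω| ^ r ≤ l ^ (r / 2) * (C * Real.cosh (t * rsum D σ ω)) := by
      intro ω
      have := hCx (t * rsum D σ ω)
      have e : |rsum D σ ω| = Real.sqrt l * |t * rsum D σ ω| := by
        rw [abs_mul, abs_of_pos ht0, ht, ← mul_assoc, mul_inv_cancel₀ hs0.ne', one_mul]
      rw [e, Real.mul_rpow hs0.le (abs_nonneg _), hsr]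
      gcongr
    have hb := cosh_rsum_le h0 D σ hσ t
    have he : Real.exp (l * (Real.cosh t - 1)) ≤ 6 := by
      have h2 : Real.cosh t - 1 ≤ t ^ 2 := cosh_sub_one_le (by
        rw [abs_of_pos ht0]; exact inv_le_one_of_one_le₀ hs)
      have h3 : l * t ^ 2 = 1 := by
        rw [ht, inv_pow, Real.sq_sqrt hl0.le, mul_inv_cancel₀ hl0.ne']
      have h6 : Real.exp 1 < (6 : ℝ) := lt_trans Real.exp_one_lt_d9 (by norm_num)
      refine le_trans (Real.exp_le_exp.2 ?_) h6.le
      nlinarith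
    calc ∑ ω, wtProd μ ω * |rsum D σ ω| ^ r
        ≤ ∑ ω, wtProd μ ω * (l ^ (r / 2) * (C * Real.cosh (t * rsum D σ ω))) :=
          Finset.sum_le_sum fun ω _ => mul_le_mul_of_nonneg_left (key ω) (wtProd_nonneg h0 h1 ω)
      _ = l ^ (r / 2) * C * (∑ ω, wtProd μ ω * Real.cosh (t * rsum D σ ω)) := by
          rw [Finset.mul_sum]
          exact Finset.sum_congr rfl fun ω _ => by ring
      _ ≤ l ^ (r / 2) * C * 6 := by gcongr; linarith
      _ = _ := by ring

/-! ### The system of functionals and vectors in `ℓ_p` -/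

lemma sum_rpow_le_rpow_sum {ι : Type*} (s : Finset ι) (d : ι → ℝ) (hd : ∀ i, 0 ≤ d i) {a : ℝ}
    (ha : 1 ≤ a) : ∑ i ∈ s, d i ^ a ≤ (∑ i ∈ s, d i) ^ a := by
  classical
  induction s using Finset.induction_on with
  | empty => simp [Real.zero_rpow (by linarith : a ≠ 0)]
  | insert i s hi ih =>
    rw [Finset.sum_insert hi, Finset.sum_insert hi]
    exact le_trans (by gcongr)
      (Real.add_rpow_le_rpow_add (hd i) (Finset.sum_nonneg fun i _ => hd i) ha)

/-- vectors in `ℓ_p` which are equivalence classes of sequences of type `e` -/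
def IsType {X : Type*} [NormedAddCommGroup X] [NormedSpace ℝ X] (p e C : ℝ)
    (x : ∀ k : ℕ, Fin (k + 1) → X) : Prop :=
  ∀ (k : ℕ) (S : Finset (Fin (k + 1))) (σ : Fin (k + 1) → ℝ), (∀ i, σ i = 1 ∨ σ i = -1) →
    ‖∑ i ∈ S, σ i • x k i‖ ≤ C * (S.card : ℝ) ^ (1 / p) ∧
    ‖∑ i ∈ S, σ i • x k i‖ ≤ C * ((k : ℝ) + 1) ^ (1 - e)

lemma norm_sum_single_inj {p : ℝ} (hp : 0 < p) {A : Type*} [Fintype A] (ψ : A → ℕ)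
    (hψ : Function.Injective ψ) (v : A → ℝ) :
    ‖∑ a, (lp.single (ENNReal.ofReal p) (ψ a) (v a) : lp (fun _ : ℕ => ℝ) (ENNReal.ofReal p))‖ ^ p
      = ∑ a, |v a| ^ p := by
  have ht : (ENNReal.ofReal p).toReal = p := ENNReal.toReal_ofReal hp.le
  have h := lp.norm_sum_single (E := fun _ : ℕ => ℝ) (p := ENNReal.ofReal p) (by rw [ht]; exact hp)
    (Function.extend ψ v 0) (Finset.univ.map ⟨ψ, hψ⟩)
  rw [Finset.sum_map, Finset.sum_map, ht] at h
  simpa [hψ.extend_apply] using h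

lemma scalar1 {r τ e' : ℝ} (hr : 2 < r) (hτ0 : 0 < τ) (hτ1 : τ < 1)
    (he : e' = r / 2 - τ * (r / 2 - 1)) {d n : ℝ} (hd : d = 0 ∨ 1 ≤ d) (hdn : d ≤ n) (hn : 1 ≤ n) :
    (d * n ^ (-τ) ≤ 1 → (n ^ (-τ))⁻¹ * (d * n ^ (-τ)) ≤ d ^ e') ∧
    (1 ≤ d * n ^ (-τ) → (n ^ (-τ))⁻¹ * (d * n ^ (-τ)) ^ (r / 2) ≤ d ^ e') := by
  have hn0 : 0 < n := by linarith
  have hμ : 0 < n ^ (-τ) := by positivity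
  have he1 : 1 ≤ e' := by rw [he]; nlinarith
  constructor
  · intro _
    rw [mul_comm d, ← mul_assoc, inv_mul_cancel₀ hμ.ne', one_mul]
    rcases hd with h | h
    · rw [h]; exact Real.rpow_nonneg le_rfl _
    · calc d = d ^ (1:ℝ) := (Real.rpow_one d).symm
        _ ≤ _ := Real.rpow_le_rpow_of_exponent_le h he1
  · intro h1
    have hd1 : 1 ≤ d := by
      rcases hd with h | h
      · rw [h] at h1; norm_num at h1
      · exact h
    have hd0 : 0 < d := by linarith
    have hmd : n ^ (-τ) ≤ d ^ (-τ) := Real.rpow_le_rpow_of_nonpos hd0 hdn (by linarith)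
    rw [Real.mul_rpow hd0.le hμ.le]
    calc (n ^ (-τ))⁻¹ * (d ^ (r / 2) * (n ^ (-τ)) ^ (r / 2))
        = d ^ (r / 2) * (n ^ (-τ)) ^ (r / 2 - 1) := by
          rw [Real.rpow_sub hμ, Real.rpow_one]; field_simp
      _ ≤ d ^ (r / 2) * (d ^ (-τ)) ^ (r / 2 - 1) := by
          gcongr
          linarith
      _ = d ^ e' := by
          rw [← Real.rpow_mul hd0.le, ← Real.rpow_add hd0, he]; ring_nf

lemma sum_fiberwise_sigma (D : Finset (Σ k : ℕ, Fin (k + 1))) (h : (Σ k : ℕ, Fin (k + 1)) → ℝ) :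
    ∑ l ∈ D, h l = ∑ k ∈ D.image Sigma.fst,
      ∑ j ∈ Finset.univ.filter (fun j : Fin (k + 1) => (⟨k, j⟩ : Σ k : ℕ, Fin (k + 1)) ∈ D),
        h ⟨k, j⟩ := by
  rw [Finset.sum_sigma' _ _ (fun k j => h ⟨k, j⟩)]
  apply Finset.sum_congr _ (fun _ _ => rfl)
  ext ⟨k, j⟩
  simp only [Finset.mem_sigma, Finset.mem_image, Finset.mem_filter, Finset.mem_univ, true_and]
  exact ⟨fun hh => ⟨⟨_, hh, rfl⟩, hh⟩, fun hh => hh.2⟩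

set_option maxHeartbeats 1000000 in
lemma exists_system (p τ e : ℝ) (hp1 : 1 < p) (hp2 : p < 2) (hτ0 : 0 < τ) (hτ1 : τ < 1)
    (he : e = (1 - τ) / 2 + τ * (1 - 1 / p)) [Fact (1 ≤ ENNReal.ofReal p)] :
    ∃ (f : ℕ → lp (fun _ : ℕ => ℝ) (ENNReal.ofReal p) →L[ℝ] ℝ)
      (g : ∀ k : ℕ, Fin (k + 1) → lp (fun _ : ℕ => ℝ) (ENNReal.ofReal p)),
      (∃ C : ℝ, 0 < C ∧ ∀ (D : Finset ℕ) y, ∑ m ∈ D, |f m y| ≤ C * (D.card : ℝ) ^ e * ‖y‖) ∧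
      (∃ C : ℝ, 0 < C ∧ IsType p e C g) ∧ ∀ k i, ∃ m, f m (g k i) = 1 := by
  have hp0 : 0 < p := by linarith
  have ht : (ENNReal.ofReal p).toReal = p := ENNReal.toReal_ofReal hp0.le
  have : Infinite (Σ k : ℕ, (Fin (k + 1) → Fin 3)) :=
    Infinite.of_injective (fun k : ℕ => (⟨k, fun _ => 0⟩ : Σ k : ℕ, (Fin (k + 1) → Fin 3)))
      (fun a b h => congrArg Sigma.fst h)
  have : Infinite (Σ k : ℕ, Fin (k + 1)) :=
    Infinite.of_injective (fun k : ℕ => (⟨k, 0⟩ : Σ k : ℕ, Fin (k + 1)))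
      (fun a b h => congrArg Sigma.fst h)
  obtain ⟨dΩ⟩ := nonempty_denumerable (Σ k : ℕ, (Fin (k + 1) → Fin 3))
  obtain ⟨dL⟩ := nonempty_denumerable (Σ k : ℕ, Fin (k + 1))
  set ιΩ : (Σ k : ℕ, (Fin (k + 1) → Fin 3)) ≃ ℕ := Denumerable.eqv _
  set ιL : (Σ k : ℕ, Fin (k + 1)) ≃ ℕ := Denumerable.eqv _
  set r : ℝ := p / (p - 1) with hr
  have hr1 : 1 / r = 1 - 1 / p := by rw [hr]; have : p - 1 ≠ 0 := by linarith
                                     field_simp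
  have hpr : p.HolderConjugate r := by
    rw [Real.holderConjugate_iff]; exact ⟨hp1, by rw [← one_div, ← one_div, hr1]; ring⟩
  have hr2 : 2 < r := by rw [hr, lt_div_iff₀ (by linarith)]; linarith
  have hr0 : 0 < r := by linarith
  set μ : ℕ → ℝ := fun k => ((k:ℝ) + 1) ^ (-τ) with hμ
  have hn1 : ∀ k : ℕ, (1:ℝ) ≤ (k:ℝ) + 1 := fun k => by linarith [Nat.cast_nonneg (α := ℝ) k]
  have hμ0 : ∀ k, 0 < μ k := fun k => by
    have := hn1 k
    simp only [hμ]; positivity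
  have hμ1 : ∀ k, μ k ≤ 1 := fun k => Real.rpow_le_one_of_one_le_of_nonpos (hn1 k) (by linarith)
  set W : ∀ k : ℕ, (Fin (k+1) → Fin 3) → ℝ := fun k ω => wtProd (μ k) ω with hW
  have hW0 : ∀ k ω, 0 ≤ W k ω := fun k ω => wtProd_nonneg (hμ0 k).le (hμ1 k) ω
  set f0 : (Σ k : ℕ, Fin (k + 1)) → (lp (fun _ : ℕ => ℝ) (ENNReal.ofReal p) →L[ℝ] ℝ) := fun l =>
    ∑ ω, (W l.1 ω ^ (1 / r) * (μ l.1)⁻¹ ^ (1 / r) * vl3 (ω l.2)) •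
      lp.evalCLM ℝ (fun _ : ℕ => ℝ) (ENNReal.ofReal p) (ιΩ ⟨l.1, ω⟩) with hf0
  have hf0a : ∀ l y, f0 l y = ∑ ω, (W l.1 ω ^ (1 / r) * (μ l.1)⁻¹ ^ (1 / r) * vl3 (ω l.2)) *
      y (ιΩ ⟨l.1, ω⟩) := by
    intro l y
    simp only [hf0, sum_apply, smul_apply, smul_eq_mul]
    rfl
  have hf0k : ∀ k (j : Fin (k + 1)) y, f0 ⟨k, j⟩ y = ∑ ω : Fin (k + 1) → Fin 3,
      (W k ω ^ (1 / r) * (μ k)⁻¹ ^ (1 / r) * vl3 (ω j)) * y (ιΩ ⟨k, ω⟩) :=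
    fun k j y => hf0a ⟨k, j⟩ y
  set g : ∀ k : ℕ, Fin (k + 1) → lp (fun _ : ℕ => ℝ) (ENNReal.ofReal p) := fun k i =>
    ∑ ω, lp.single (ENNReal.ofReal p) (ιΩ ⟨k, ω⟩)
      (W k ω ^ (1 / p) * (μ k)⁻¹ ^ (1 / p) * vl3 (ω i)) with hg
  have hinj : ∀ k, Function.Injective (fun ω : Fin (k+1) → Fin 3 => ιΩ ⟨k, ω⟩) := by
    intro k a b hab
    have := ιΩ.injective hab
    simpa using this
  refine ⟨fun m => f0 (ιL.symm m), g, ?_, ?_, ?_⟩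
  · obtain ⟨C, hC, hM⟩ := moment_rsum r hr0
    refine ⟨C ^ (1 / r), by positivity, ?_⟩
    have main : ∀ (D : Finset (Σ k : ℕ, Fin (k + 1))) y,
        ∑ l ∈ D, |f0 l y| ≤ C ^ (1 / r) * (D.card : ℝ) ^ e * ‖y‖ := by
      intro D y
      set σ : (Σ k : ℕ, Fin (k + 1)) → ℝ := fun l => if 0 ≤ f0 l y then 1 else -1 with hσ
      have hσ1 : ∀ l, σ l = 1 ∨ σ l = -1 := fun l => by
        simp only [hσ]; split_ifs <;> simp
      have hσ2 : ∀ l, |f0 l y| = σ l * f0 l y := fun l => by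
        simp only [hσ]; split_ifs with h
        · rw [abs_of_nonneg h, one_mul]
        · rw [abs_of_neg (not_le.1 h)]; ring
      set K := D.image Sigma.fst
      set Dk : ∀ k : ℕ, Finset (Fin (k+1)) := fun k => Finset.univ.filter
        (fun j : Fin (k + 1) => (⟨k, j⟩ : Σ k : ℕ, Fin (k + 1)) ∈ D) with hDk
      set G : (Σ k : ℕ, (Fin (k + 1) → Fin 3)) → ℝ := fun a =>
        W a.1 a.2 ^ (1 / r) * (μ a.1)⁻¹ ^ (1 / r) * rsum (Dk a.1) (fun j => σ ⟨a.1, j⟩) a.2 with hG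
      set A : Finset (Σ k : ℕ, (Fin (k + 1) → Fin 3)) := K.sigma (fun _ => Finset.univ)
      have e1 : ∑ l ∈ D, |f0 l y| = ∑ a ∈ A, G a * y (ιΩ a) := by
        simp only [hσ2]
        rw [sum_fiberwise_sigma, Finset.sum_sigma]
        refine Finset.sum_congr rfl fun k _ => ?_
        obtain ⟨Y, hY⟩ : ∃ Y : ℕ → ℝ, ∀ m, y m = Y m := ⟨_, fun _ => rfl⟩
        simp only [hf0k, Finset.mul_sum, hY]
        rw [Finset.sum_comm]
        refine Finset.sum_congr rfl fun ω _ => ?_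
        simp only [hG, rsum, Finset.mul_sum, Finset.sum_mul]
        refine Finset.sum_congr rfl fun j _ => ?_
        ring
      have e2 := Real.inner_le_Lp_mul_Lq A G (fun a => y (ιΩ a)) hpr.symm
      have e3 : (∑ a ∈ A, |y (ιΩ a)| ^ p) ^ (1 / p) ≤ ‖y‖ := by
        have := lp.sum_rpow_le_norm_rpow (by rw [ht]; exact hp0) y (A.map ιΩ.toEmbedding)
        rw [Finset.sum_map, ht] at this
        calc (∑ a ∈ A, |y (ιΩ a)| ^ p) ^ (1 / p) ≤ (‖y‖ ^ p) ^ (1 / p) := by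
              gcongr
              exact this
          _ = ‖y‖ := by rw [one_div, Real.rpow_rpow_inv (norm_nonneg _) hp0.ne']
      have hre : r * e = r / 2 - τ * (r / 2 - 1) := by
        rw [he, ← hr1]; field_simp; ring
      have hre1 : 1 ≤ r * e := by rw [hre]; nlinarith
      have e4 : ∑ a ∈ A, |G a| ^ r ≤ C * (D.card : ℝ) ^ (r * e) := by
        have hc : (D.card : ℝ) = ∑ k ∈ K, ((Dk k).card : ℝ) := by
          have := sum_fiberwise_sigma D (fun _ => 1)
          simpa using this
        rw [hc, Finset.sum_sigma]
        refine le_trans ?_ (mul_le_mul_of_nonneg_left (sum_rpow_le_rpow_sum K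
          (fun k => ((Dk k).card : ℝ)) (fun _ => Nat.cast_nonneg _) hre1) hC.le)
        rw [Finset.mul_sum]
        refine Finset.sum_le_sum fun k _ => ?_
        have hGr : ∀ ω, |G ⟨k, ω⟩| ^ r =
            (μ k)⁻¹ * (W k ω * |rsum (Dk k) (fun j => σ ⟨k, j⟩) ω| ^ r) := by
          intro ω
          have h1 := hW0 k ω
          have h2 := inv_nonneg.2 (hμ0 k).le
          simp only [hG]
          rw [abs_mul, abs_of_nonneg (by positivity), Real.mul_rpow (by positivity) (abs_nonneg _),
            Real.mul_rpow (by positivity) (by positivity), one_div,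
            Real.rpow_inv_rpow h1 hr0.ne', Real.rpow_inv_rpow h2 hr0.ne']
          ring
        simp only [hGr]
        rw [← Finset.mul_sum]
        obtain ⟨hM1, hM2⟩ := hM (μ k) (hμ0 k).le (hμ1 k) (k+1) (Dk k) (fun j => σ ⟨k, j⟩)
          (fun j => hσ1 _)
        have hd : ((Dk k).card : ℝ) = 0 ∨ (1:ℝ) ≤ (Dk k).card := by
          rcases Nat.eq_zero_or_pos (Dk k).card with h | h
          · left; exact_mod_cast h
          · right; exact_mod_cast h
        have hdn : ((Dk k).card : ℝ) ≤ (k:ℝ) + 1 := by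
          have := Finset.card_le_univ (Dk k)
          rw [Fintype.card_fin] at this
          exact_mod_cast this
        obtain ⟨s1, s2⟩ := scalar1 hr2 hτ0 hτ1 hre hd hdn (hn1 k)
        have hinv := inv_nonneg.2 (hμ0 k).le
        rcases le_total (((Dk k).card : ℝ) * μ k) 1 with h | h
        · calc _ ≤ (μ k)⁻¹ * (C * ((Dk k).card * μ k)) := by gcongr; exact hM1 h
            _ = C * ((μ k)⁻¹ * ((Dk k).card * μ k)) := by ring
            _ ≤ _ := by gcongr; exact s1 h
        · calc _ ≤ (μ k)⁻¹ * (C * ((Dk k).card * μ k) ^ (r / 2)) := by gcongr; exact hM2 h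
            _ = C * ((μ k)⁻¹ * ((Dk k).card * μ k) ^ (r / 2)) := by ring
            _ ≤ _ := by gcongr; exact s2 h
      rw [e1]
      refine e2.trans ?_
      have e5 : (∑ a ∈ A, |G a| ^ r) ^ (1 / r) ≤ C ^ (1 / r) * (D.card : ℝ) ^ e := by
        calc (∑ a ∈ A, |G a| ^ r) ^ (1 / r) ≤ (C * (D.card : ℝ) ^ (r * e)) ^ (1 / r) := by gcongr
          _ = _ := by
            rw [Real.mul_rpow hC.le (by positivity), ← Real.rpow_mul (by positivity)]
            congr 2; field_simp
      exact mul_le_mul e5 e3 (by positivity) (by positivity)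
    intro D y
    have := main (D.map ιL.symm.toEmbedding) y
    rw [Finset.sum_map, Finset.card_map] at this
    exact this
  · obtain ⟨C, hC, hM⟩ := moment_rsum p hp0
    refine ⟨C ^ (1 / p), by positivity, ?_⟩
    intro k S σ hσ
    have e1 : ∑ i ∈ S, σ i • g k i = ∑ ω, lp.single (ENNReal.ofReal p) (ιΩ ⟨k, ω⟩)
        (W k ω ^ (1 / p) * (μ k)⁻¹ ^ (1 / p) * rsum S σ ω) := by
      simp only [hg, Finset.smul_sum]
      rw [Finset.sum_comm]
      refine Finset.sum_congr rfl fun ω _ => ?_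
      ext m
      simp only [rsum, lp.coeFn_sum, Finset.sum_apply, lp.coeFn_smul, Pi.smul_apply,
        lp.single_apply, Pi.single_apply, smul_eq_mul]
      split_ifs
      · rw [Finset.mul_sum]
        exact Finset.sum_congr rfl fun j _ => by ring
      · simp
    have e2 := norm_sum_single_inj hp0 _ (hinj k)
      (fun ω => W k ω ^ (1 / p) * (μ k)⁻¹ ^ (1 / p) * rsum S σ ω)
    rw [← e1] at e2
    have hGr : ∀ ω, |W k ω ^ (1 / p) * (μ k)⁻¹ ^ (1 / p) * rsum S σ ω| ^ p =
        (μ k)⁻¹ * (W k ω * |rsum S σ ω| ^ p) := by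
      intro ω
      have h1 := hW0 k ω
      have h2 := inv_nonneg.2 (hμ0 k).le
      rw [abs_mul, abs_of_nonneg (by positivity), Real.mul_rpow (by positivity) (abs_nonneg _),
        Real.mul_rpow (by positivity) (by positivity), one_div,
        Real.rpow_inv_rpow h1 hp0.ne', Real.rpow_inv_rpow h2 hp0.ne']
      ring
    simp only [hGr] at e2
    rw [← Finset.mul_sum] at e2
    obtain ⟨hM1, hM2⟩ := hM (μ k) (hμ0 k).le (hμ1 k) (k+1) S σ hσ
    have hinv := inv_nonneg.2 (hμ0 k).le
    have hS0 : (0:ℝ) ≤ S.card := Nat.cast_nonneg _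
    have hl0 : 0 ≤ (S.card : ℝ) * μ k := mul_nonneg hS0 (hμ0 k).le
    have hdn : (S.card : ℝ) ≤ (k:ℝ) + 1 := by
      have := Finset.card_le_univ S
      rw [Fintype.card_fin] at this
      exact_mod_cast this
    have a1 : ∑ ω, W k ω * |rsum S σ ω| ^ p ≤ C * (S.card * μ k) := by
      rcases le_total ((S.card : ℝ) * μ k) 1 with h | h
      · exact hM1 h
      · refine (hM2 h).trans ?_
        gcongr
        calc ((S.card : ℝ) * μ k) ^ (p / 2) ≤ ((S.card : ℝ) * μ k) ^ (1:ℝ) :=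
              Real.rpow_le_rpow_of_exponent_le h (by linarith)
          _ = _ := Real.rpow_one _
    have a2 : ∑ ω, W k ω * |rsum S σ ω| ^ p ≤ C * (S.card * μ k) ^ (p / 2) := by
      rcases le_total ((S.card : ℝ) * μ k) 1 with h | h
      · refine (hM1 h).trans ?_
        gcongr
        calc (S.card : ℝ) * μ k = ((S.card : ℝ) * μ k) ^ (1:ℝ) := (Real.rpow_one _).symm
          _ ≤ ((S.card : ℝ) * μ k) ^ (p / 2) :=
              Real.rpow_le_rpow_of_exponent_ge' hl0 h (by linarith) (by linarith)
      · exact hM2 h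
    have fin : ∀ B : ℝ, 0 ≤ B → ‖∑ i ∈ S, σ i • g k i‖ ^ p ≤ C * B →
        ‖∑ i ∈ S, σ i • g k i‖ ≤ C ^ (1 / p) * B ^ (1 / p) := by
      intro B hB h
      rw [← Real.mul_rpow hC.le hB]
      calc _ = (‖∑ i ∈ S, σ i • g k i‖ ^ p) ^ (1 / p) := by
            rw [one_div, Real.rpow_rpow_inv (norm_nonneg _) hp0.ne']
        _ ≤ _ := by gcongr
    constructor
    · refine fin _ hS0 ?_
      rw [e2]
      calc _ ≤ (μ k)⁻¹ * (C * (S.card * μ k)) := by gcongr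
        _ = _ := by have := (hμ0 k).ne'; field_simp
    · have hk0 : (0:ℝ) < (k:ℝ) + 1 := by linarith [hn1 k]
      have : ((k:ℝ) + 1) ^ (1 - e) = (((k:ℝ) + 1) ^ (p * (1 - e))) ^ (1 / p) := by
        rw [← Real.rpow_mul hk0.le]; congr 1; field_simp
      rw [this]
      refine fin _ (by positivity) ?_
      rw [e2]
      calc _ ≤ (μ k)⁻¹ * (C * (S.card * μ k) ^ (p / 2)) := by gcongr
        _ ≤ (μ k)⁻¹ * (C * (((k:ℝ) + 1) * μ k) ^ (p / 2)) := by
          have := (hμ0 k).le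
          gcongr
        _ = C * ((k:ℝ) + 1) ^ (p * (1 - e)) := by
          rw [Real.mul_rpow hk0.le (hμ0 k).le]
          simp only [hμ]
          rw [← Real.rpow_neg hk0.le, ← Real.rpow_mul hk0.le]
          have : p * (1 - e) = - -τ + (p / 2 + -τ * (p / 2)) := by
            rw [he]; field_simp; ring
          rw [this, Real.rpow_add hk0, Real.rpow_add hk0]; ring
  · intro k i
    refine ⟨ιL ⟨k, i⟩, ?_⟩
    simp only [Equiv.symm_apply_apply]
    rw [hf0a]
    have hgc : ∀ ω, g k i (ιΩ ⟨k, ω⟩) = W k ω ^ (1 / p) * (μ k)⁻¹ ^ (1 / p) * vl3 (ω i) := by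
      intro ω
      simp only [hg, lp.coeFn_sum, Finset.sum_apply, lp.single_apply, Pi.single_apply]
      rw [Finset.sum_eq_single ω]
      · simp
      · intro b _ hb
        rw [if_neg]
        intro h; exact hb (hinj k h.symm)
      · simp
    simp only [hgc]
    have h1 : 1 / r + 1 / p = 1 := by rw [hr1]; ring
    have : ∀ ω : Fin (k+1) → Fin 3,
        W k ω ^ (1 / r) * (μ k)⁻¹ ^ (1 / r) * vl3 (ω i) *
        (W k ω ^ (1 / p) * (μ k)⁻¹ ^ (1 / p) * vl3 (ω i)) =
        (μ k)⁻¹ * (W k ω * vl3 (ω i) ^ 2) := by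
      intro ω
      have a1 : W k ω ^ (1 / r) * W k ω ^ (1 / p) = W k ω := by
        rw [← Real.rpow_add' (hW0 k ω) (by rw [h1]; norm_num), h1, Real.rpow_one]
      have a2 : (μ k)⁻¹ ^ (1 / r) * (μ k)⁻¹ ^ (1 / p) = (μ k)⁻¹ := by
        rw [← Real.rpow_add (inv_pos.2 (hμ0 k)), h1, Real.rpow_one]
      calc _ = (W k ω ^ (1 / r) * W k ω ^ (1 / p)) *
            ((μ k)⁻¹ ^ (1 / r) * (μ k)⁻¹ ^ (1 / p)) * vl3 (ω i) ^ 2 := by ring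
        _ = _ := by rw [a1, a2]; ring
    simp only [this]
    rw [← Finset.mul_sum]
    simp only [hW]
    rw [sum_wtProd_sq, inv_mul_cancel₀ (hμ0 k).ne']


/-! ### The weak type estimate and the operator -/

lemma weak_sum (a : ℕ → ℝ) (ha : ∀ m, 0 ≤ a m) (C e s : ℝ) (hC : 0 ≤ C) (hs : 0 < s)
    (h : ∀ D : Finset ℕ, ∑ m ∈ D, a m ≤ C * (D.card : ℝ) ^ e) :
    ∀ (n : ℕ) (D : Finset ℕ), D.card = n →
      ∑ m ∈ D, a m ^ s ≤ C ^ s * ∑ i ∈ Finset.range n, ((i : ℝ) + 1) ^ (-((1 - e) * s)) := by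
  intro n
  induction n with
  | zero =>
    intro D hD
    rw [Finset.card_eq_zero] at hD
    simp [hD]
  | succ n ih =>
    intro D hD
    have hne : D.Nonempty := Finset.card_pos.1 (by omega)
    obtain ⟨m, hm, hmin⟩ := Finset.exists_min_image D a hne
    have h1 := Finset.card_nsmul_le_sum D a (a m) hmin
    have h2 := h D
    rw [hD] at h1 h2
    rw [nsmul_eq_mul] at h1
    push_cast at h1 h2
    have hn : (0:ℝ) < (n:ℝ) + 1 := by positivity
    have h3 : a m ≤ C * ((n:ℝ) + 1) ^ (e - 1) := by
      rw [Real.rpow_sub_one hn.ne', ← mul_div_assoc, le_div_iff₀ hn]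
      linarith
    have h4 : a m ^ s ≤ C ^ s * ((n:ℝ) + 1) ^ (-((1 - e) * s)) := by
      calc a m ^ s ≤ (C * ((n:ℝ) + 1) ^ (e - 1)) ^ s := Real.rpow_le_rpow (ha m) h3 hs.le
        _ = C ^ s * ((n:ℝ) + 1) ^ (-((1 - e) * s)) := by
          rw [Real.mul_rpow hC (by positivity), ← Real.rpow_mul hn.le]
          congr 2; ring
    rw [Finset.sum_range_succ, mul_add, ← Finset.sum_erase_add D _ hm]
    have := ih (D.erase m) (by rw [Finset.card_erase_of_mem hm, hD]; rfl)
    linarith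

lemma exists_op {X : Type*} [NormedAddCommGroup X] [NormedSpace ℝ X] (q e : ℝ) (hq : 1 < q)
    (he : e < 1 - 1 / q) [Fact (1 ≤ ENNReal.ofReal q)] (φ : ℕ → X →L[ℝ] ℝ) (C : ℝ) (hC : 0 < C)
    (h : ∀ (D : Finset ℕ) x, ∑ m ∈ D, |φ m x| ≤ C * (D.card : ℝ) ^ e * ‖x‖) :
    ∃ T : X →L[ℝ] lp (fun _ : ℕ => ℝ) (ENNReal.ofReal q),
      (∀ x m, T x m = φ m x) ∧ ∀ ε : ℝ, 0 < ε → ∃ M : ℝ, 0 < M ∧ ∀ x t, 0 ≤ t →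
        (∀ m, |φ m x| ≤ t) → ‖T x‖ ≤ ε * ‖x‖ + M * t := by
  have hq0 : 0 < q := by linarith
  have ht : (ENNReal.ofReal q).toReal = q := ENNReal.toReal_ofReal hq0.le
  have he1 : 0 < 1 - e := by
    have : 0 < 1 / q := by positivity
    linarith
  obtain ⟨s, hs1, hs2⟩ : ∃ s, 1 / (1 - e) < s ∧ s < q := by
    apply exists_between
    rw [div_lt_iff₀ he1]
    have : q * (1 / q) = 1 := by field_simp
    nlinarith
  have hs0 : 0 < s := lt_trans (by positivity) hs1
  have hsum : Summable (fun i : ℕ => ((i : ℝ) + 1) ^ (-((1 - e) * s))) := by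
    have h1 : Summable (fun i : ℕ => (i : ℝ) ^ (-((1 - e) * s))) := by
      rw [Real.summable_nat_rpow]
      rw [div_lt_iff₀ he1] at hs1
      linarith
    have := (summable_nat_add_iff 1).2 h1
    simpa using this
  obtain ⟨Z, hZ0, hZ⟩ : ∃ Z : ℝ, 0 < Z ∧
      ∀ n, ∑ i ∈ Finset.range n, ((i : ℝ) + 1) ^ (-((1 - e) * s)) ≤ Z := by
    refine ⟨(∑' i : ℕ, ((i : ℝ) + 1) ^ (-((1 - e) * s))) + 1, ?_, fun n => ?_⟩
    · have : 0 ≤ ∑' i : ℕ, ((i : ℝ) + 1) ^ (-((1 - e) * s)) :=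
        tsum_nonneg fun i => by positivity
      linarith
    · have := hsum.sum_le_tsum (Finset.range n) (fun i _ => by positivity)
      linarith
  have hone : ∀ m x, |φ m x| ≤ C * ‖x‖ := by
    intro m x
    simpa using h {m} x
  have key : ∀ x t, 0 ≤ t → (∀ m, |φ m x| ≤ t) → ∀ D : Finset ℕ,
      ∑ m ∈ D, |φ m x| ^ q ≤ t ^ (q - s) * ((C * ‖x‖) ^ s * Z) := by
    intro x t ht0 htm D
    have h1 := weak_sum (fun m => |φ m x|) (fun m => abs_nonneg _) (C * ‖x‖) e s (by positivity) hs0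
      (fun D => by have := h D x; linarith) D.card D rfl
    calc ∑ m ∈ D, |φ m x| ^ q ≤ ∑ m ∈ D, t ^ (q - s) * |φ m x| ^ s := by
          refine Finset.sum_le_sum fun m _ => ?_
          have : q = (q - s) + s := by ring
          calc |φ m x| ^ q = |φ m x| ^ (q - s) * |φ m x| ^ s := by
                rw [← Real.rpow_add_of_nonneg (abs_nonneg _) (by linarith) hs0.le]
                congr 1
            _ ≤ _ := by
                gcongr
                exact htm m
      _ = t ^ (q - s) * ∑ m ∈ D, |φ m x| ^ s := by rw [Finset.mul_sum]
      _ ≤ t ^ (q - s) * ((C * ‖x‖) ^ s * Z) := by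
          gcongr
          refine h1.trans ?_
          gcongr
          exact hZ _
  have key2 : ∀ x, ∀ D : Finset ℕ, ∑ m ∈ D, |φ m x| ^ q ≤ (C * Z ^ (1 / q) * ‖x‖) ^ q := by
    intro x D
    refine (key x (C * ‖x‖) (by positivity) (fun m => hone m x) D).trans (le_of_eq ?_)
    rw [← mul_assoc, ← Real.rpow_add_of_nonneg (by positivity) (by linarith) hs0.le]
    have : C * Z ^ (1 / q) * ‖x‖ = (C * ‖x‖) * Z ^ (1 / q) := by ring
    rw [this, Real.mul_rpow (x := C * ‖x‖) (y := Z ^ (1 / q)) (by positivity) (by positivity), one_div,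
      Real.rpow_inv_rpow hZ0.le hq0.ne']
    congr 2; ring
  have hmem : ∀ x, Memℓp (fun m => φ m x) (ENNReal.ofReal q) := by
    intro x
    refine memℓp_gen' (C := (C * Z ^ (1 / q) * ‖x‖) ^ q) fun D => ?_
    rw [ht]
    exact key2 x D
  let T0 : X →ₗ[ℝ] lp (fun _ : ℕ => ℝ) (ENNReal.ofReal q) :=
    { toFun := fun x => ⟨fun m => φ m x, hmem x⟩
      map_add' := fun x y => by ext m; exact (φ m).map_add x y
      map_smul' := fun c x => by ext m; exact (φ m).map_smul c x }
  have hT0 : ∀ x m, T0 x m = φ m x := fun x m => rfl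
  have hT0n : ∀ x, ‖T0 x‖ ≤ C * Z ^ (1 / q) * ‖x‖ := by
    intro x
    refine lp.norm_le_of_forall_sum_le (by rw [ht]; exact hq0) (by positivity) fun D => ?_
    rw [ht]
    exact key2 x D
  refine ⟨T0.mkContinuous _ hT0n, fun x m => rfl, fun ε hε => ?_⟩
  set B := C * Z ^ (1 / q) with hB
  have hB0 : 0 < B := by positivity
  set κ := (ε ^ q / (C ^ s * Z)) ^ (1 / (q - s)) with hκ
  have hκ0 : 0 < κ := by positivity
  have hκ1 : κ ^ (q - s) * (C ^ s * Z) = ε ^ q := by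
    rw [hκ, one_div, Real.rpow_inv_rpow (by positivity) (by linarith)]
    field_simp
  refine ⟨B / κ, by positivity, fun x t ht0 htm => ?_⟩
  change ‖T0 x‖ ≤ _
  by_cases hc : t ≤ κ * ‖x‖
  · have : ‖T0 x‖ ≤ ε * ‖x‖ := by
      refine lp.norm_le_of_forall_sum_le (by rw [ht]; exact hq0) (by positivity) fun D => ?_
      rw [ht]
      refine (key x t ht0 htm D).trans ?_
      calc t ^ (q - s) * ((C * ‖x‖) ^ s * Z) ≤ (κ * ‖x‖) ^ (q - s) * ((C * ‖x‖) ^ s * Z) := by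
            gcongr
        _ = (κ ^ (q - s) * (C ^ s * Z)) * (‖x‖ ^ (q - s) * ‖x‖ ^ s) := by
            rw [Real.mul_rpow hκ0.le (norm_nonneg _), Real.mul_rpow hC.le (norm_nonneg _)]; ring
        _ = (ε * ‖x‖) ^ q := by
            rw [hκ1, ← Real.rpow_add_of_nonneg (norm_nonneg _) (by linarith) hs0.le,
              Real.mul_rpow hε.le (norm_nonneg _)]
            congr 2; ring
    have : 0 ≤ B / κ * t := by positivity
    linarith
  · push Not at hc
    have h1 : ‖x‖ ≤ t / κ := by rw [le_div_iff₀ hκ0]; linarith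
    have : B * ‖x‖ ≤ B / κ * t := by
      calc B * ‖x‖ ≤ B * (t / κ) := by gcongr
        _ = _ := by ring
    have : 0 ≤ ε * ‖x‖ := by positivity
    linarith [hT0n x]

/-- The copy of `ℓ_q` or `c₀` gives an operator bounded below by coordinates. -/
lemma exists_coord_op {X : Type*} [NormedAddCommGroup X] [NormedSpace ℝ X] (q : ℝ) (hq : 1 < q)
    [Fact (1 ≤ ENNReal.ofReal q)]
    (hcopy : (∃ (J : lp (fun _ : ℕ => ℝ) (ENNReal.ofReal q) →L[ℝ] X) (c : ℝ),
          0 < c ∧ ∀ z, c * ‖z‖ ≤ ‖J z‖)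
        ∨ (∃ (J : ZeroAtInftyContinuousMap ℕ ℝ →L[ℝ] X) (c : ℝ),
          0 < c ∧ ∀ z, c * ‖z‖ ≤ ‖J z‖)) :
    ∃ (J : lp (fun _ : ℕ => ℝ) (ENNReal.ofReal q) →L[ℝ] X) (c : ℝ),
          0 < c ∧ ∀ z m, c * |z m| ≤ ‖J z‖ := by
  have hq0 : 0 < q := by linarith
  have ht : (ENNReal.ofReal q).toReal = q := ENNReal.toReal_ofReal hq0.le
  have hne : ENNReal.ofReal q ≠ 0 := by simpa using hq0
  have hco : ∀ (z : lp (fun _ : ℕ => ℝ) (ENNReal.ofReal q)) m, |z m| ≤ ‖z‖ :=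
    fun z m => lp.norm_apply_le_norm hne z m
  rcases hcopy with ⟨J, c, hc, hJ⟩ | ⟨J, c, hc, hJ⟩
  · refine ⟨J, c, hc, fun z m => le_trans ?_ (hJ z)⟩
    have := hco z m
    gcongr
  · have hz : ∀ z : lp (fun _ : ℕ => ℝ) (ENNReal.ofReal q),
        Filter.Tendsto (fun m => z m) (Filter.cocompact ℕ) (nhds 0) := by
      intro z
      rw [Filter.cocompact_eq_cofinite]
      have h1 := (lp.memℓp z).summable (by rw [ht]; exact hq0)
      rw [ht] at h1
      have h2 := h1.tendsto_cofinite_zero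
      have h3 : Filter.Tendsto (fun m => (‖z m‖ ^ q) ^ (1 / q)) Filter.cofinite
          (nhds ((0:ℝ) ^ (1 / q))) :=
        h2.rpow_const (Or.inr (by positivity))
      rw [Real.zero_rpow (by positivity)] at h3
      rw [tendsto_zero_iff_norm_tendsto_zero]
      refine h3.congr fun m => ?_
      rw [one_div, Real.rpow_rpow_inv (norm_nonneg _) hq0.ne']
    let I0 : lp (fun _ : ℕ => ℝ) (ENNReal.ofReal q) →ₗ[ℝ] ZeroAtInftyContinuousMap ℕ ℝ :=
      { toFun := fun z => ⟨⟨fun m => z m, continuous_of_discreteTopology⟩, hz z⟩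
        map_add' := fun x y => by ext m; rfl
        map_smul' := fun c x => by ext m; rfl }
    have hI0 : ∀ z m, I0 z m = z m := fun z m => rfl
    have hI1 : ∀ z, ‖I0 z‖ ≤ 1 * ‖z‖ := by
      intro z
      rw [← ZeroAtInftyContinuousMap.norm_toBCF_eq_norm, one_mul]
      refine (BoundedContinuousFunction.norm_le (norm_nonneg _)).2 fun m => ?_
      exact hco z m
    refine ⟨J.comp (I0.mkContinuous 1 hI1), c, hc, fun z m => le_trans ?_ (hJ (I0 z))⟩
    have : |I0 z m| ≤ ‖I0 z‖ := by
      rw [← ZeroAtInftyContinuousMap.norm_toBCF_eq_norm]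
      exact (I0 z).toBCF.norm_coe_le_norm m
    rw [hI0] at this
    gcongr

/-! ### The ideal of operators controlled by good families of functionals -/

section IdealF

variable {X : Type*} [NormedAddCommGroup X] [NormedSpace ℝ X]

def GoodFam {ι : Type} (φ : ι → X →L[ℝ] ℝ) : Prop :=
  ∀ ε : ℝ, 0 < ε → ∃ M : ℝ, 0 < M ∧ ∀ (D : Finset ι) x,
    ∑ l ∈ D, |φ l x| ≤ (ε * D.card + M) * ‖x‖

def Ctrl (V : X →L[ℝ] X) : Prop :=
  ∀ ε : ℝ, 0 < ε → ∃ (ι : Type) (φ : ι → X →L[ℝ] ℝ), GoodFam φ ∧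
    ∀ x t, 0 ≤ t → (∀ l, |φ l x| ≤ t) → ‖V x‖ ≤ ε * ‖x‖ + t

lemma GoodFam.smul_comp {ι : Type} {φ : ι → X →L[ℝ] ℝ} (h : GoodFam φ) (b : ℝ) (A : X →L[ℝ] X) :
    GoodFam (fun l => b • (φ l).comp A) := by
  intro ε hε
  set a := ‖A‖ + 1 with ha
  have ha0 : 0 < a := by positivity
  set c := |b| + 1 with hc
  have hc0 : 0 < c := by positivity
  obtain ⟨M, hM, H⟩ := h (ε / (a * c)) (by positivity)
  refine ⟨a * c * M, by positivity, fun D x => ?_⟩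
  have h1 : ∑ l ∈ D, |(b • (φ l).comp A) x| = |b| * ∑ l ∈ D, |φ l (A x)| := by
    simp [Finset.mul_sum, abs_mul]
  have h2 : ‖A x‖ ≤ a * ‖x‖ := by
    have := A.le_opNorm x
    have := norm_nonneg x
    rw [ha]; nlinarith
  rw [h1]
  calc |b| * ∑ l ∈ D, |φ l (A x)| ≤ c * ∑ l ∈ D, |φ l (A x)| := by
        gcongr
        rw [hc]; linarith
    _ ≤ c * ((ε / (a * c) * D.card + M) * ‖A x‖) := by gcongr; exact H D _
    _ ≤ c * ((ε / (a * c) * D.card + M) * (a * ‖x‖)) := by gcongr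
    _ = (ε * D.card + a * c * M) * ‖x‖ := by field_simp

lemma Ctrl.comp {V : X →L[ℝ] X} (h : Ctrl V) (A B : X →L[ℝ] X) : Ctrl (B.comp (V.comp A)) := by
  intro ε hε
  set a := ‖A‖ + 1 with ha
  have ha0 : 0 < a := by positivity
  set b := ‖B‖ + 1 with hb
  have hb0 : 0 < b := by positivity
  obtain ⟨ι, φ, hφ, H⟩ := h (ε / (a * b)) (by positivity)
  refine ⟨ι, fun l => b • (φ l).comp A, hφ.smul_comp b A, fun x t ht hx => ?_⟩
  have h1 := H (A x) (t / b) (by positivity) (fun l => by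
    have := hx l
    simp only [smul_apply, ContinuousLinearMap.comp_apply, smul_eq_mul, abs_mul, abs_of_pos hb0]
      at this
    rw [le_div_iff₀ hb0]; linarith)
  have h2 : ‖A x‖ ≤ a * ‖x‖ := by
    have := A.le_opNorm x
    have := norm_nonneg x
    rw [ha]; nlinarith
  calc ‖B (V (A x))‖ ≤ ‖B‖ * ‖V (A x)‖ := B.le_opNorm _
    _ ≤ b * ‖V (A x)‖ := by
        gcongr
        rw [hb]; linarith
    _ ≤ b * (ε / (a * b) * ‖A x‖ + t / b) := by gcongr
    _ ≤ b * (ε / (a * b) * (a * ‖x‖) + t / b) := by gcongr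
    _ = ε * ‖x‖ + t := by field_simp

lemma Ctrl.add {V W : X →L[ℝ] X} (hV : Ctrl V) (hW : Ctrl W) : Ctrl (V + W) := by
  intro ε hε
  obtain ⟨ι, φ, hφ, H⟩ := hV (ε / 2) (by positivity)
  obtain ⟨κ, ψ, hψ, K⟩ := hW (ε / 2) (by positivity)
  refine ⟨ι ⊕ κ, Sum.elim (fun l => (2:ℝ) • φ l) (fun l => (2:ℝ) • ψ l), ?_, ?_⟩
  · intro δ hδ
    obtain ⟨M, hM, H1⟩ := hφ (δ / 4) (by positivity)
    obtain ⟨N, hN, K1⟩ := hψ (δ / 4) (by positivity)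
    refine ⟨2 * M + 2 * N, by positivity, fun D x => ?_⟩
    have e1 : ∑ l ∈ D, |(Sum.elim (fun l => (2:ℝ) • φ l) (fun l => (2:ℝ) • ψ l) l) x|
        = 2 * ∑ l ∈ D.toLeft, |φ l x| + 2 * ∑ l ∈ D.toRight, |ψ l x| := by
      conv_lhs => rw [← Finset.toLeft_disjSum_toRight (u := D)]
      rw [Finset.sum_disjSum]
      simp [Finset.mul_sum, abs_mul]
    have c1 : ((D.toLeft.card : ℕ) : ℝ) ≤ D.card := by exact_mod_cast Finset.card_toLeft_le
    have c2 : ((D.toRight.card : ℕ) : ℝ) ≤ D.card := by exact_mod_cast Finset.card_toRight_le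
    rw [e1]
    have h1 : ∑ l ∈ D.toLeft, |φ l x| ≤ (δ / 4 * D.card + M) * ‖x‖ :=
      (H1 _ x).trans (by gcongr)
    have h2 : ∑ l ∈ D.toRight, |ψ l x| ≤ (δ / 4 * D.card + N) * ‖x‖ :=
      (K1 _ x).trans (by gcongr)
    linarith
  · intro x t ht hx
    have h1 := H x (t / 2) (by positivity) (fun l => by
      have := hx (Sum.inl l)
      simp [abs_mul] at this
      linarith)
    have h2 := K x (t / 2) (by positivity) (fun l => by
      have := hx (Sum.inr l)
      simp [abs_mul] at this
      linarith)
    have := norm_add_le (V x) (W x)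
    change ‖V x + W x‖ ≤ _
    linarith

variable (X) in
def idF : Submodule ℝ (X →L[ℝ] X) where
  carrier := {V | Ctrl V}
  zero_mem' := by
    intro ε hε
    refine ⟨Empty, fun l => l.elim, fun δ hδ => ⟨1, one_pos, fun D x => ?_⟩, fun x t ht _ => ?_⟩
    · rw [Finset.eq_empty_of_isEmpty D]; simp
    · simp; positivity
  add_mem' := fun h1 h2 => Ctrl.add h1 h2
  smul_mem' := fun c V hV => by
    have := Ctrl.comp hV (ContinuousLinearMap.id ℝ X) (c • ContinuousLinearMap.id ℝ X)
    exact this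

lemma mem_idF {V : X →L[ℝ] X} : V ∈ idF X ↔ Ctrl V := Iff.rfl

lemma idF_closed : IsClosed (idF X : Set (X →L[ℝ] X)) := by
  rw [← closure_subset_iff_isClosed]
  intro V hV ε hε
  rw [Metric.mem_closure_iff] at hV
  obtain ⟨W, hW, hd⟩ := hV (ε / 2) (by positivity)
  obtain ⟨ι, φ, hφ, H⟩ := (hW : Ctrl W) (ε / 2) (by positivity)
  refine ⟨ι, φ, hφ, fun x t ht hx => ?_⟩
  have h1 := H x t ht hx
  have h2 := (V - W).le_opNorm x
  rw [dist_eq_norm] at hd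
  have h3 : ‖V - W‖ * ‖x‖ ≤ ε / 2 * ‖x‖ := by gcongr
  have h4 : ‖V x‖ ≤ ‖(V - W) x‖ + ‖W x‖ := by
    have := norm_add_le ((V - W) x) (W x)
    simpa using this
  linarith

lemma Ctrl.fss {V : X →L[ℝ] X} (hV : Ctrl V) : FinStrictSing V := by
  intro ε hε
  obtain ⟨ι, φ, hφ, H⟩ := hV (ε / 2) (by positivity)
  obtain ⟨M, hM, G⟩ := hφ (ε / 8) (by positivity)
  obtain ⟨n, hn⟩ := exists_nat_gt (8 * M / ε)
  have hn0 : 0 < n := by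
    have : (0:ℝ) < n := lt_trans (by positivity) hn
    exact_mod_cast this
  refine ⟨n, fun E hE => ?_⟩
  by_contra! hcon
  have hE1 : ∀ x ∈ E, ε * ‖x‖ ≤ ‖V x‖ := by
    intro x hx
    by_cases h0 : x = 0
    · simp [h0]
    · exact hcon x hx h0
  have hfin : FiniteDimensional ℝ E := Module.finite_of_finrank_pos (by omega)
  set K : Set E := {x : E | ∀ l, |φ l x| ≤ 1} with hK
  have hKb : ∀ x ∈ K, ‖x‖ ≤ 2 / ε := by
    intro x hx
    have h1 := H x 1 zero_le_one hx
    have h2 := hE1 x x.2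
    rw [le_div_iff₀ hε]
    have h3 : ‖(x : X)‖ = ‖x‖ := rfl
    rw [h3] at h1 h2
    linarith
  have hKc : IsCompact K := by
    have : ProperSpace E := FiniteDimensional.proper_real E
    apply Metric.isCompact_of_isClosed_isBounded
    · rw [hK, Set.setOf_forall]
      refine isClosed_iInter fun l => isClosed_le ?_ continuous_const
      fun_prop
    · refine (Metric.isBounded_closedBall (x := (0 : E)) (r := 2 / ε)).subset fun x hx => ?_
      rw [mem_closedBall_zero_iff]
      exact hKb x hx
  obtain ⟨x, hx⟩ := hKc.extremePoints_nonempty ⟨0, fun l => by simp⟩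
  have hxK : x ∈ K := hx.1
  by_cases hD : ∃ D : Finset ι, D.card = n ∧ ∀ l ∈ D, 1 / 2 ≤ |φ l x|
  · obtain ⟨D, hDn, hD⟩ := hD
    have h1 := Finset.card_nsmul_le_sum D (fun l => |φ l x|) (1 / 2) hD
    have h2 := G D x
    rw [hDn, nsmul_eq_mul] at h1
    rw [hDn] at h2
    have h3 : (ε / 8 * n + M) * ‖(x : X)‖ ≤ (ε / 8 * n + M) * (2 / ε) := by
      gcongr
      exact hKb x hxK
    have h4 : (ε / 8 * n + M) * (2 / ε) = n / 4 + (8 * M / ε) / 4 := by field_simp; ring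
    linarith
  · have hBf : {l | 1 / 2 ≤ |φ l x|}.Finite := by
      by_contra hinf
      obtain ⟨D, hD1, hD2⟩ := Set.Infinite.exists_subset_card_eq hinf n
      exact hD ⟨D, hD2, fun l hl => hD1 hl⟩
    have hBc : hBf.toFinset.card < n := by
      by_contra! hc
      obtain ⟨D, hD1, hD2⟩ := Finset.exists_subset_card_eq hc
      exact hD ⟨D, hD2, fun l hl => by simpa using hD1 hl⟩
    let F : E →ₗ[ℝ] (hBf.toFinset → ℝ) :=
      LinearMap.pi fun l => ((φ l.1).toLinearMap.comp E.subtype)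
    have hker : LinearMap.ker F ≠ ⊥ := by
      apply LinearMap.ker_ne_bot_of_finrank_lt
      rw [Module.finrank_fintype_fun_eq_card, Fintype.card_coe, hE]
      exact hBc
    obtain ⟨v, hv, hv0⟩ := (Submodule.ne_bot_iff _).1 hker
    have hv1 : ∀ l, 1 / 2 ≤ |φ l x| → φ l v = 0 := by
      intro l hl
      have := congrFun (LinearMap.mem_ker.1 hv) ⟨l, by simpa using hl⟩
      exact this
    set R := ε / 8 + M with hR
    have hR0 : 0 < R := by positivity
    have hφR : ∀ l, |φ l v| ≤ R * ‖v‖ := by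
      intro l
      simpa using G {l} v
    set c := 1 / (2 * (R * ‖v‖ + 1)) with hc
    have hc0 : 0 < c := by positivity
    have hcv : ∀ l, c * |φ l v| ≤ 1 / 2 := by
      intro l
      calc c * |φ l v| ≤ c * (R * ‖v‖ + 1) := by
            gcongr
            linarith [hφR l]
        _ = 1 / 2 := by rw [hc]; field_simp
    have hmem : ∀ σ : ℝ, |σ| = c → x + σ • v ∈ K := by
      intro σ hσ l
      have e1 : φ l ((x + σ • v : E) : X) = φ l x + σ * φ l v := by simp
      rw [e1]
      by_cases hl : 1 / 2 ≤ |φ l x|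
      · rw [hv1 l hl]; simpa using hxK l
      · push Not at hl
        have := abs_add_le (φ l x) (σ * φ l v)
        rw [abs_mul, hσ] at this
        linarith [hcv l]
    have h1 := hmem c (abs_of_pos hc0)
    have h2 := hmem (-c) (by rw [abs_neg, abs_of_pos hc0])
    have h3 : x ∈ openSegment ℝ (x + c • v) (x + (-c) • v) := by
      refine ⟨1 / 2, 1 / 2, by norm_num, by norm_num, by norm_num, ?_⟩
      module
    have h4 := hx.2 h1 h2 h3
    have h5 : c • v = 0 := by simpa using h4
    rcases smul_eq_zero.1 h5 with h | h
    · exact hc0.ne' h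
    · exact hv0 h

lemma ctrl_of_est (e : ℝ) (he0 : 0 < e) (he1 : e < 1) (φ : ℕ → X →L[ℝ] ℝ) (C : ℝ) (hC : 0 < C)
    (h : ∀ (D : Finset ℕ) x, ∑ m ∈ D, |φ m x| ≤ C * (D.card : ℝ) ^ e * ‖x‖) (V : X →L[ℝ] X)
    (hV : ∀ ε : ℝ, 0 < ε → ∃ M : ℝ, 0 < M ∧ ∀ x t, 0 ≤ t →
        (∀ m, |φ m x| ≤ t) → ‖V x‖ ≤ ε * ‖x‖ + M * t) : Ctrl V := by
  have hgood : GoodFam φ := by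
    intro ε hε
    set n0 := (C / ε) ^ (1 / (1 - e)) with hn0
    have hn00 : 0 < n0 := by positivity
    have hn1 : n0 ^ (1 - e) = C / ε := by
      rw [hn0, one_div, Real.rpow_inv_rpow (by positivity) (by linarith)]
    refine ⟨C * n0 ^ e, by positivity, fun D x => (h D x).trans ?_⟩
    gcongr
    rcases le_total (D.card : ℝ) n0 with hc | hc
    · have : C * (D.card : ℝ) ^ e ≤ C * n0 ^ e := by gcongr
      have : 0 ≤ ε * (D.card : ℝ) := by positivity
      linarith
    · have hp : (0:ℝ) < D.card := by linarith
      have h1 : C / ε ≤ (D.card : ℝ) ^ (1 - e) := by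
        rw [← hn1]
        exact Real.rpow_le_rpow hn00.le hc (by linarith)
      rw [div_le_iff₀ hε] at h1
      have : C * (D.card : ℝ) ^ e ≤ ε * D.card := by
        calc C * (D.card : ℝ) ^ e ≤ (D.card : ℝ) ^ (1 - e) * ε * (D.card : ℝ) ^ e := by gcongr
          _ = ε * ((D.card : ℝ) ^ (1 - e) * (D.card : ℝ) ^ e) := by ring
          _ = ε * D.card := by rw [← Real.rpow_add hp]; simp
      have : 0 ≤ C * n0 ^ e := by positivity
      linarith
  intro ε hε
  obtain ⟨M, hM, H⟩ := hV ε hε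
  refine ⟨ℕ, fun l => M • (φ l).comp (ContinuousLinearMap.id ℝ X), hgood.smul_comp _ _,
    fun x t ht hx => ?_⟩
  have := H x (t / M) (by positivity) (fun m => by
    have := hx m
    simp [abs_mul, abs_of_pos hM] at this
    rw [le_div_iff₀ hM]; linarith)
  rwa [mul_div_cancel₀ _ hM.ne'] at this

end IdealF

/-! ### The ideals of operators small on average on typed systems -/

section IdealK

open Filter Topology

variable {X : Type*} [NormedAddCommGroup X] [NormedSpace ℝ X]

lemma IsType.norm_le {p e C : ℝ} {x : ∀ k : ℕ, Fin (k + 1) → X} (h : IsType p e C x) (k : ℕ)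
    (i : Fin (k + 1)) : ‖x k i‖ ≤ C := by
  have := (h k {i} (fun _ => 1) (fun _ => Or.inl rfl)).1
  simpa using this

lemma IsType.const_nonneg {p e C : ℝ} {x : ∀ k : ℕ, Fin (k + 1) → X} (h : IsType p e C x) :
    0 ≤ C := (norm_nonneg _).trans (h.norm_le 0 0)

lemma IsType.map {Y : Type*} [NormedAddCommGroup Y] [NormedSpace ℝ Y] {p e C : ℝ}
    {x : ∀ k : ℕ, Fin (k + 1) → X} (h : IsType p e C x)
    (A : X →L[ℝ] Y) : IsType p e (‖A‖ * C) (fun k i => A (x k i)) := by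
  intro k S σ hσ
  have e1 : ∑ i ∈ S, σ i • A (x k i) = A (∑ i ∈ S, σ i • x k i) := by simp
  obtain ⟨h1, h2⟩ := h k S σ hσ
  rw [e1]
  refine ⟨(A.le_opNorm _).trans ?_, (A.le_opNorm _).trans ?_⟩ <;> rw [mul_assoc] <;> gcongr

lemma IsType.anti {p e e' C : ℝ} {x : ∀ k : ℕ, Fin (k + 1) → X} (h : IsType p e' C x)
    (hee : e ≤ e') : IsType p e C x := by
  intro k S σ hσ
  obtain ⟨h1, h2⟩ := h k S σ hσ
  refine ⟨h1, h2.trans ?_⟩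
  have := h.const_nonneg
  gcongr
  linarith [Nat.cast_nonneg (α := ℝ) k]

def SmallOn (p e : ℝ) (V : X →L[ℝ] X) : Prop :=
  ∀ (C : ℝ) (x : ∀ k : ℕ, Fin (k + 1) → X), IsType p e C x →
    Tendsto (fun k : ℕ => (∑ i, ‖V (x k i)‖) / ((k : ℝ) + 1)) atTop (𝓝 0)

lemma SmallOn.mono {p e e' : ℝ} {V : X →L[ℝ] X} (h : SmallOn p e V) (hee : e ≤ e') :
    SmallOn p e' V := fun C x hx => h C x (hx.anti hee)

lemma SmallOn.comp {p e : ℝ} {V : X →L[ℝ] X} (h : SmallOn p e V) (A B : X →L[ℝ] X) :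
    SmallOn p e (B.comp (V.comp A)) := by
  intro C x hx
  have h1 := (h _ _ (hx.map A)).const_mul ‖B‖
  rw [mul_zero] at h1
  refine squeeze_zero (fun k => by positivity) (fun k => ?_) h1
  rw [← mul_div_assoc, Finset.mul_sum]
  gcongr with i
  exact B.le_opNorm _

variable (X) in
def idK (p e : ℝ) : Submodule ℝ (X →L[ℝ] X) where
  carrier := {V | SmallOn p e V}
  zero_mem' := by
    intro C x hx
    simp
  add_mem' := by
    intro V W hV hW C x hx
    have h1 := (hV C x hx).add (hW C x hx)
    rw [add_zero] at h1
    refine squeeze_zero (fun k => by positivity) (fun k => ?_) h1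
    rw [← add_div, ← Finset.sum_add_distrib]
    gcongr with i
    exact norm_add_le _ _
  smul_mem' := fun c V hV => by
    have := SmallOn.comp hV (ContinuousLinearMap.id ℝ X) (c • ContinuousLinearMap.id ℝ X)
    exact this

lemma avg_le {k : ℕ} (a : Fin (k + 1) → ℝ) (B : ℝ) (h : ∀ i, a i ≤ B) :
    (∑ i, a i) / ((k : ℝ) + 1) ≤ B := by
  rw [div_le_iff₀ (by positivity)]
  calc ∑ i, a i ≤ ∑ i : Fin (k + 1), B := Finset.sum_le_sum fun i _ => h i
    _ = B * ((k : ℝ) + 1) := by simp; ring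

lemma idK_closed (p e : ℝ) : IsClosed (idK X p e : Set (X →L[ℝ] X)) := by
  rw [← closure_subset_iff_isClosed]
  intro V hV C x hx
  have hC := hx.const_nonneg
  rw [Metric.mem_closure_iff] at hV
  rw [Metric.tendsto_atTop]
  intro ε hε
  obtain ⟨W, hW, hd⟩ := hV (ε / (2 * (C + 1))) (by positivity)
  have h1 := (hW : SmallOn p e W) C x hx
  rw [Metric.tendsto_atTop] at h1
  obtain ⟨N, hN⟩ := h1 (ε / 2) (by positivity)
  refine ⟨N, fun k hk => ?_⟩
  have h2 := hN k hk
  rw [Real.dist_0_eq_abs, abs_of_nonneg (by positivity)] at h2 ⊢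
  rw [dist_eq_norm] at hd
  have h3 : (∑ i, ‖V (x k i)‖) / ((k : ℝ) + 1) ≤
      (∑ i, ‖(V - W) (x k i)‖) / ((k : ℝ) + 1) + (∑ i, ‖W (x k i)‖) / ((k : ℝ) + 1) := by
    rw [← add_div, ← Finset.sum_add_distrib]
    gcongr with i
    have := norm_add_le ((V - W) (x k i)) (W (x k i))
    simpa using this
  have h4 : (∑ i, ‖(V - W) (x k i)‖) / ((k : ℝ) + 1) ≤ ε / (2 * (C + 1)) * C := by
    refine avg_le _ _ fun i => ((V - W).le_opNorm _).trans ?_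
    gcongr
    exact hx.norm_le k i
  have h5 : ε / (2 * (C + 1)) * C ≤ ε / 2 := by
    rw [div_mul_eq_mul_div, div_le_div_iff₀ (by positivity) (by positivity)]
    nlinarith
  linarith

lemma signs_diag_sum {ι : Type*} [DecidableEq ι] (b : ι → ι → ℝ) (D : Finset ι) :
    ∃ σ : ι → ℝ, (∀ i, σ i = 1 ∨ σ i = -1) ∧
      ∑ m ∈ D, b m m ≤ ∑ m ∈ D, ∑ n ∈ D, σ m * σ n * b m n := by
  induction D using Finset.induction_on with
  | empty => exact ⟨fun _ => 1, fun _ => Or.inl rfl, by simp⟩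
  | insert a D ha ih =>
    obtain ⟨σ, hσ, h⟩ := ih
    set S := ∑ m ∈ D, σ m * (b a m + b m a) with hS
    obtain ⟨s, hs, hsS⟩ : ∃ s : ℝ, (s = 1 ∨ s = -1) ∧ 0 ≤ s * S := by
      rcases le_total 0 S with h | h
      · exact ⟨1, Or.inl rfl, by linarith⟩
      · exact ⟨-1, Or.inr rfl, by linarith⟩
    refine ⟨Function.update σ a s, fun i => ?_, ?_⟩
    · by_cases hi : i = a
      · subst hi; simpa using hs
      · simpa [Function.update_of_ne hi] using hσ i
    · have hne : ∀ m ∈ D, Function.update σ a s m = σ m := fun m hm =>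
        Function.update_of_ne (ne_of_mem_of_not_mem hm ha) _ _
      have hss : s * s = 1 := by rcases hs with h | h <;> rw [h] <;> norm_num
      have e1 : ∑ m ∈ insert a D, ∑ n ∈ insert a D,
          Function.update σ a s m * Function.update σ a s n * b m n
          = b a a + s * S + ∑ m ∈ D, ∑ n ∈ D, σ m * σ n * b m n := by
        rw [Finset.sum_insert ha, Finset.sum_insert ha]
        have t1 : ∑ n ∈ D, Function.update σ a s a * Function.update σ a s n * b a n
            = ∑ n ∈ D, s * (σ n * b a n) := by
          refine Finset.sum_congr rfl fun n hn => ?_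
          rw [hne n hn, Function.update_self]; ring
        have t2 : ∑ m ∈ D, ∑ n ∈ insert a D,
            Function.update σ a s m * Function.update σ a s n * b m n
            = ∑ m ∈ D, (s * (σ m * b m a) + ∑ n ∈ D, σ m * σ n * b m n) := by
          refine Finset.sum_congr rfl fun m hm => ?_
          rw [Finset.sum_insert ha, hne m hm, Function.update_self]
          congr 1
          · ring
          · exact Finset.sum_congr rfl fun n hn => by rw [hne n hn]
        rw [t1, t2, Function.update_self, hss, Finset.sum_add_distrib, hS, Finset.mul_sum]
        simp only [mul_add, Finset.sum_add_distrib]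
        ring
      rw [e1, Finset.sum_insert ha]
      linarith

lemma exists_sgn (a : ℝ) : ∃ s : ℝ, (s = 1 ∨ s = -1) ∧ s * a = |a| := by
  rcases le_total 0 a with h | h
  · exact ⟨1, Or.inl rfl, by rw [abs_of_nonneg h, one_mul]⟩
  · exact ⟨-1, Or.inr rfl, by rw [abs_of_nonpos h]; ring⟩

lemma diag_bound {p e e' C C' η : ℝ} (hC : 0 < C) (φ : ℕ → X →L[ℝ] ℝ)
    (h : ∀ (D : Finset ℕ) x, ∑ m ∈ D, |φ m x| ≤ C * (D.card : ℝ) ^ e * ‖x‖)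
    {x : ∀ k : ℕ, Fin (k + 1) → X} (hx : IsType p e' C' x) (k : ℕ) (D : Finset ℕ)
    (i : ℕ → Fin (k + 1)) (hi : Set.InjOn i D) (hη : ∀ m ∈ D, η ≤ |φ m (x k (i m))|) :
    η * D.card ≤ C * (D.card : ℝ) ^ e * (C' * ((k : ℝ) + 1) ^ (1 - e')) := by
  classical
  choose s hs1 hs2 using fun m => exists_sgn (φ m (x k (i m)))
  obtain ⟨σ, hσ, hb⟩ := signs_diag_sum (fun m n => s m * φ m (x k (i n))) D
  set z := ∑ m ∈ D, σ m • x k (i m) with hz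
  have h1 : η * D.card ≤ ∑ m ∈ D, s m * φ m (x k (i m)) := by
    have := Finset.card_nsmul_le_sum D (fun m => s m * φ m (x k (i m))) η
      (fun m hm => by rw [hs2]; exact hη m hm)
    rw [nsmul_eq_mul] at this
    linarith
  have h2 : ∑ m ∈ D, ∑ n ∈ D, σ m * σ n * (s m * φ m (x k (i n))) ≤ ∑ m ∈ D, |φ m z| := by
    refine Finset.sum_le_sum fun m _ => ?_
    have e1 : ∑ n ∈ D, σ m * σ n * (s m * φ m (x k (i n))) = σ m * s m * φ m z := by
      rw [hz, map_sum, Finset.mul_sum]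
      refine Finset.sum_congr rfl fun n _ => ?_
      rw [map_smul, smul_eq_mul]; ring
    rw [e1]
    refine (le_abs_self _).trans (le_of_eq ?_)
    rw [abs_mul, abs_mul]
    have a1 : |σ m| = 1 := by rcases hσ m with h | h <;> rw [h] <;> simp
    have a2 : |s m| = 1 := by rcases hs1 m with h | h <;> rw [h] <;> simp
    rw [a1, a2]; ring
  have h3 : ‖z‖ ≤ C' * ((k : ℝ) + 1) ^ (1 - e') := by
    have e1 : z = ∑ j ∈ D.image i, σ (Function.invFunOn i D j) • x k j := by
      rw [Finset.sum_image hi, hz]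
      refine Finset.sum_congr rfl fun m hm => ?_
      rw [hi.leftInvOn_invFunOn hm]
    rw [e1]
    exact (hx k _ (fun j => σ (Function.invFunOn i D j)) (fun j => hσ _)).2
  calc η * D.card ≤ ∑ m ∈ D, |φ m z| := h1.trans (hb.trans h2)
    _ ≤ C * (D.card : ℝ) ^ e * ‖z‖ := h D z
    _ ≤ _ := by gcongr

lemma fiber_bound {p e e' C C' η : ℝ} (hp : 1 < p) (hC : 0 < C) (hη0 : 0 < η) (φ : ℕ → X →L[ℝ] ℝ)
    (h : ∀ (D : Finset ℕ) x, ∑ m ∈ D, |φ m x| ≤ C * (D.card : ℝ) ^ e * ‖x‖)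
    {x : ∀ k : ℕ, Fin (k + 1) → X} (hx : IsType p e' C' x) (k : ℕ) (F : Finset (Fin (k + 1)))
    (m : ℕ) (hη : ∀ i ∈ F, η ≤ |φ m (x k i)|) :
    (F.card : ℝ) ≤ (C * C' / η) ^ (1 / (1 - 1 / p)) := by
  have hC' := hx.const_nonneg
  have hp1 : 0 < 1 - 1 / p := by
    have : 1 / p < 1 := by rw [div_lt_one (by linarith)]; exact hp
    linarith
  rcases Nat.eq_zero_or_pos F.card with h0 | h0
  · rw [h0, Nat.cast_zero]; positivity
  have hF : (0:ℝ) < F.card := by exact_mod_cast h0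
  choose s hs1 hs2 using fun i => exists_sgn (φ m (x k i))
  have h1 : η * F.card ≤ ∑ i ∈ F, s i * φ m (x k i) := by
    have := Finset.card_nsmul_le_sum F (fun i => s i * φ m (x k i)) η
      (fun m hm => by rw [hs2]; exact hη m hm)
    rw [nsmul_eq_mul] at this
    linarith
  have h2 : ∑ i ∈ F, s i * φ m (x k i) = φ m (∑ i ∈ F, s i • x k i) := by simp
  have h3 : |φ m (∑ i ∈ F, s i • x k i)| ≤ C * ‖∑ i ∈ F, s i • x k i‖ := by
    simpa using h {m} (∑ i ∈ F, s i • x k i)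
  have h4 := (hx k F s hs1).1
  have h5 : η * F.card ≤ C * (C' * (F.card : ℝ) ^ (1 / p)) := by
    calc η * F.card ≤ |φ m (∑ i ∈ F, s i • x k i)| := by
          rw [h2] at h1; exact h1.trans (le_abs_self _)
      _ ≤ _ := h3.trans (by gcongr)
  have h6 : (F.card : ℝ) ^ (1 - 1 / p) ≤ C * C' / η := by
    rw [le_div_iff₀ hη0, Real.rpow_sub hF, Real.rpow_one, div_mul_eq_mul_div,
      div_le_iff₀ (by positivity)]
    linarith
  calc (F.card : ℝ) = ((F.card : ℝ) ^ (1 - 1 / p)) ^ (1 / (1 - 1 / p)) := by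
        rw [one_div (1 - 1 / p), Real.rpow_rpow_inv hF.le hp1.ne']
    _ ≤ _ := by gcongr

lemma big_bound {p e e' C C' η : ℝ} (hp : 1 < p) (he : 0 ≤ e) (hC : 0 < C) (hη0 : 0 < η)
    (φ : ℕ → X →L[ℝ] ℝ)
    (h : ∀ (D : Finset ℕ) x, ∑ m ∈ D, |φ m x| ≤ C * (D.card : ℝ) ^ e * ‖x‖)
    {x : ∀ k : ℕ, Fin (k + 1) → X} (hx : IsType p e' C' x) :
    ∃ K : ℝ, 0 ≤ K ∧ ∀ (k : ℕ) (A : Finset (Fin (k + 1))), (∀ i ∈ A, ∃ m, η ≤ |φ m (x k i)|) →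
      (A.card : ℝ) ≤ K * ((k : ℝ) + 1) ^ (1 - (e' - e)) := by
  classical
  have hC' := hx.const_nonneg
  set N0 := ⌈(C * C' / η) ^ (1 / (1 - 1 / p))⌉₊ with hN0
  refine ⟨N0 * (C * C' / η), by positivity, fun k A hA => ?_⟩
  have hl : ∃ l : Fin (k + 1) → ℕ, ∀ i ∈ A, η ≤ |φ (l i) (x k i)| := by
    choose! l hl using hA
    exact ⟨l, hl⟩
  obtain ⟨l, hl⟩ := hl
  set D := A.image l with hD
  have hinv : ∀ m, ∃ i, m ∈ D → i ∈ A ∧ l i = m := by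
    intro m
    by_cases hm : m ∈ D
    · obtain ⟨i, h1, h2⟩ := Finset.mem_image.1 hm
      exact ⟨i, fun _ => ⟨h1, h2⟩⟩
    · exact ⟨0, fun h => absurd h hm⟩
  choose i hi using hinv
  have c1 : A.card ≤ N0 * D.card := by
    refine Finset.card_le_mul_card_image A N0 fun m hm => ?_
    have := fiber_bound hp hC hη0 φ h hx k (A.filter (fun i => l i = m)) m (fun i hi => by
      rw [Finset.mem_filter] at hi
      rw [← hi.2]
      exact hl i hi.1)
    have := this.trans (Nat.le_ceil _)
    exact_mod_cast this
  have c2 := diag_bound hC φ h hx k D i (fun m hm m' hm' hmm => by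
      rw [← (hi m hm).2, ← (hi m' hm').2, hmm]) (fun m hm => by
      have := hl (i m) (hi m hm).1
      rwa [(hi m hm).2] at this)
  have hk : (0:ℝ) < (k : ℝ) + 1 := by positivity
  have c3 : (D.card : ℝ) ≤ (k : ℝ) + 1 := by
    have : D.card ≤ k + 1 := Finset.card_image_le.trans ((Finset.card_le_univ A).trans (by simp))
    exact_mod_cast this
  have c4 : (D.card : ℝ) ≤ C * C' / η * ((k : ℝ) + 1) ^ (1 - (e' - e)) := by
    rw [div_mul_eq_mul_div, le_div_iff₀ hη0]
    calc (D.card : ℝ) * η ≤ C * (D.card : ℝ) ^ e * (C' * ((k : ℝ) + 1) ^ (1 - e')) := by linarith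
      _ ≤ C * ((k : ℝ) + 1) ^ e * (C' * ((k : ℝ) + 1) ^ (1 - e')) := by gcongr
      _ = C * C' * (((k : ℝ) + 1) ^ e * ((k : ℝ) + 1) ^ (1 - e')) := by ring
      _ = _ := by
        rw [← Real.rpow_add hk]
        congr 2; ring
  calc (A.card : ℝ) ≤ N0 * D.card := by exact_mod_cast c1
    _ ≤ N0 * (C * C' / η * ((k : ℝ) + 1) ^ (1 - (e' - e))) := by gcongr
    _ = _ := by ring

lemma small_of_est {p e e' C : ℝ} (hp : 1 < p) (he : 0 ≤ e) (hee : e < e') (hC : 0 < C)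
    (φ : ℕ → X →L[ℝ] ℝ)
    (h : ∀ (D : Finset ℕ) x, ∑ m ∈ D, |φ m x| ≤ C * (D.card : ℝ) ^ e * ‖x‖) (V : X →L[ℝ] X)
    (hV : ∀ ε : ℝ, 0 < ε → ∃ M : ℝ, 0 < M ∧ ∀ x t, 0 ≤ t →
        (∀ m, |φ m x| ≤ t) → ‖V x‖ ≤ ε * ‖x‖ + M * t) : SmallOn p e' V := by
  classical
  intro C' x hx
  have hC' := hx.const_nonneg
  rw [Metric.tendsto_atTop]
  intro δ hδ
  obtain ⟨M, hM, H⟩ := hV (δ / (4 * (C' + 1))) (by positivity)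
  set η := δ / (4 * M) with hη
  have hη0 : 0 < η := by positivity
  obtain ⟨K, hK, HK⟩ := big_bound hp he hC hη0 φ h hx
  set a := e' - e with ha
  have ha0 : 0 < a := by rw [ha]; linarith
  have hlim : Tendsto (fun k : ℕ => ‖V‖ * C' * K * ((k : ℝ) + 1) ^ (-a)) atTop (𝓝 0) := by
    have h1 : Tendsto (fun k : ℕ => (k : ℝ) + 1) atTop atTop :=
      tendsto_atTop_add_const_right _ _ tendsto_natCast_atTop_atTop
    have := ((tendsto_rpow_neg_atTop ha0).comp h1).const_mul (‖V‖ * C' * K)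
    simpa using this
  rw [Metric.tendsto_atTop] at hlim
  obtain ⟨N, hN⟩ := hlim (δ / 2) (by positivity)
  refine ⟨N, fun k hk => ?_⟩
  have h2 := hN k hk
  have hk1 : (0:ℝ) < (k : ℝ) + 1 := by positivity
  rw [Real.dist_0_eq_abs, abs_of_nonneg (by positivity)] at h2 ⊢
  set A : Finset (Fin (k + 1)) := Finset.univ.filter (fun i => ∃ m, η ≤ |φ m (x k i)|) with hA
  have hAc := HK k A (fun i hi => (Finset.mem_filter.1 hi).2)
  have hpt : ∀ i, ‖V (x k i)‖ ≤ δ / 2 + (if i ∈ A then ‖V‖ * C' else 0) := by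
    intro i
    have hn := hx.norm_le k i
    split_ifs with hi
    · have h3 : ‖V (x k i)‖ ≤ ‖V‖ * C' := (V.le_opNorm _).trans (by gcongr)
      linarith
    · have h3 : ∀ m, |φ m (x k i)| ≤ η := by
        intro m
        by_contra! hc
        exact hi (Finset.mem_filter.2 ⟨Finset.mem_univ _, m, hc.le⟩)
      have h4 := H (x k i) η hη0.le h3
      have h5 : δ / (4 * (C' + 1)) * ‖x k i‖ ≤ δ / 4 := by
        calc δ / (4 * (C' + 1)) * ‖x k i‖ ≤ δ / (4 * (C' + 1)) * (C' + 1) := by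
              gcongr; linarith
          _ = δ / 4 := by field_simp
      have h6 : M * η = δ / 4 := by rw [hη]; field_simp
      linarith
  have hsum : ∑ i, ‖V (x k i)‖ ≤ δ / 2 * ((k : ℝ) + 1) + A.card * (‖V‖ * C') := by
    refine (Finset.sum_le_sum fun i _ => hpt i).trans (le_of_eq ?_)
    rw [Finset.sum_add_distrib, Finset.sum_ite_mem]
    simp
    ring
  have h7 : (A.card : ℝ) * (‖V‖ * C') ≤ ‖V‖ * C' * K * ((k : ℝ) + 1) ^ (-a) * ((k : ℝ) + 1) := by
    calc (A.card : ℝ) * (‖V‖ * C') ≤ K * ((k : ℝ) + 1) ^ (1 - a) * (‖V‖ * C') := by gcongr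
      _ = ‖V‖ * C' * K * (((k : ℝ) + 1) ^ (-a) * ((k : ℝ) + 1) ^ (1 : ℝ)) := by
        rw [← Real.rpow_add hk1, show -a + 1 = 1 - a by ring]; ring
      _ = _ := by rw [Real.rpow_one]; ring
  rw [div_lt_iff₀ hk1]
  have h8 : ‖V‖ * C' * K * ((k : ℝ) + 1) ^ (-a) * ((k : ℝ) + 1) < δ / 2 * ((k : ℝ) + 1) := by
    gcongr
  linarith

end IdealK

/-! ### Assembling -/

lemma exists_V {X : Type*} [NormedAddCommGroup X] [NormedSpace ℝ X]
    (p q e : ℝ) (hp1 : 1 < p) (hp2 : p < 2) (hpq : p < q)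
    [Fact (1 ≤ ENNReal.ofReal p)] [Fact (1 ≤ ENNReal.ofReal q)]
    (P : X →L[ℝ] lp (fun _ : ℕ => ℝ) (ENNReal.ofReal p))
    (Q : lp (fun _ : ℕ => ℝ) (ENNReal.ofReal p) →L[ℝ] X) (hPQ : ∀ z, P (Q z) = z)
    (J : lp (fun _ : ℕ => ℝ) (ENNReal.ofReal q) →L[ℝ] X) (c : ℝ)
    (hc : 0 < c) (hJ : ∀ z m, c * |z m| ≤ ‖J z‖)
    (he1 : 1 - 1 / p < e) (he2 : e < 1 / 2) (he3 : e < 1 - 1 / q) :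
    ∃ V : X →L[ℝ] X, Ctrl V ∧ (∀ e', e < e' → SmallOn p e' V) ∧ ¬ SmallOn p e V := by
  have hp0 : 0 < p := by linarith
  have hpi : 1 / p < 1 := by rw [div_lt_one hp0]; exact hp1
  have hpi2 : 1 / 2 < 1 / p := by
    rw [div_lt_div_iff₀ (by norm_num) hp0]; linarith
  have hd : 0 < 1 / p - 1 / 2 := by linarith
  obtain ⟨f, g, ⟨C, hC, hf⟩, ⟨C2, hC2, hg⟩, hfg⟩ := exists_system p ((1 / 2 - e) / (1 / p - 1 / 2)) e
    hp1 hp2 (div_pos (by linarith) hd) (by rw [div_lt_one hd]; linarith)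
    (by
      have : (1 / 2 - e) / (1 / p - 1 / 2) * (1 / p - 1 / 2) = 1 / 2 - e :=
        div_mul_cancel₀ _ hd.ne'
      linarith)
  set φ : ℕ → X →L[ℝ] ℝ := fun m => (f m).comp P with hφ
  set C1 := C * (‖P‖ + 1) with hC1
  have hC10 : 0 < C1 := by positivity
  have hφ1 : ∀ (D : Finset ℕ) x, ∑ m ∈ D, |φ m x| ≤ C1 * (D.card : ℝ) ^ e * ‖x‖ := by
    intro D x
    calc ∑ m ∈ D, |φ m x| ≤ C * (D.card : ℝ) ^ e * ‖P x‖ := hf D (P x)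
      _ ≤ C * (D.card : ℝ) ^ e * ((‖P‖ + 1) * ‖x‖) := by
          gcongr
          have := P.le_opNorm x
          have := norm_nonneg x
          linarith
      _ = _ := by rw [hC1]; ring
  obtain ⟨T, hT1, hT2⟩ := exists_op q e (by linarith) he3 φ C1 hC10 hφ1
  have hV : ∀ ε : ℝ, 0 < ε → ∃ M : ℝ, 0 < M ∧ ∀ x t, 0 ≤ t →
        (∀ m, |φ m x| ≤ t) → ‖(J.comp T) x‖ ≤ ε * ‖x‖ + M * t := by
    intro ε hε
    set b := ‖J‖ + 1 with hb
    have hb0 : 0 < b := by positivity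
    obtain ⟨M, hM, H⟩ := hT2 (ε / b) (by positivity)
    refine ⟨b * M, by positivity, fun x t ht hx => ?_⟩
    calc ‖J (T x)‖ ≤ ‖J‖ * ‖T x‖ := J.le_opNorm _
      _ ≤ b * ‖T x‖ := by gcongr; rw [hb]; linarith
      _ ≤ b * (ε / b * ‖x‖ + M * t) := by gcongr; exact H x t ht hx
      _ = _ := by field_simp
  refine ⟨J.comp T, ctrl_of_est e (by linarith) (by linarith) φ C1 hC10 hφ1 _ hV,
    fun e' hee => small_of_est hp1 (by linarith) hee hC10 φ hφ1 _ hV, fun hcon => ?_⟩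
  have h1 := hcon _ _ (hg.map Q)
  have h2 : ∀ k : ℕ, c ≤ (∑ i, ‖(J.comp T) (Q (g k i))‖) / ((k : ℝ) + 1) := by
    intro k
    rw [le_div_iff₀ (by positivity)]
    have h3 : ∀ i, c ≤ ‖(J.comp T) (Q (g k i))‖ := by
      intro i
      obtain ⟨m, hm⟩ := hfg k i
      have h4 := hJ (T (Q (g k i))) m
      have h5 : T (Q (g k i)) m = 1 := by
        rw [hT1]
        change f m (P (Q (g k i))) = 1
        rw [hPQ, hm]
      rw [h5] at h4
      simpa using h4
    calc c * ((k : ℝ) + 1) = ∑ i : Fin (k + 1), c := by simp; ring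
      _ ≤ _ := Finset.sum_le_sum fun i _ => h3 i
  have := ge_of_tendsto' h1 h2
  linarith

/-- If `1 < p < 2`, `p < q < ∞`, and the real Banach space `X` contains a
complemented copy of `ℓ_p` and an isomorphic copy of `ℓ_q` or of `c₀`, then `L(X)` admits
a chain `(𝔍 r)_{r ∈ (0,1)}`, of the cardinality of the continuum, of closed ideals
consisting of finitely strictly singular operators. -/
theorem statement0 (p q : ℝ) (hp1 : 1 < p) (hp2 : p < 2) (hpq : p < q)
    [Fact (1 ≤ ENNReal.ofReal p)] [Fact (1 ≤ ENNReal.ofReal q)]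
    (X : Type*) [NormedAddCommGroup X] [NormedSpace ℝ X] [CompleteSpace X]
    (hcompl : ∃ (P : X →L[ℝ] lp (fun _ : ℕ => ℝ) (ENNReal.ofReal p))
        (Q : lp (fun _ : ℕ => ℝ) (ENNReal.ofReal p) →L[ℝ] X), ∀ z, P (Q z) = z)
    (hcopy : (∃ (J : lp (fun _ : ℕ => ℝ) (ENNReal.ofReal q) →L[ℝ] X) (c : ℝ),
          0 < c ∧ ∀ z, c * ‖z‖ ≤ ‖J z‖)
        ∨ (∃ (J : ZeroAtInftyContinuousMap ℕ ℝ →L[ℝ] X) (c : ℝ),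
          0 < c ∧ ∀ z, c * ‖z‖ ≤ ‖J z‖)) :
    ∃ 𝔍 : ℝ → Submodule ℝ (X →L[ℝ] X),
      (∀ r ∈ Set.Ioo (0:ℝ) 1,
        IsClosed ((𝔍 r : Set (X →L[ℝ] X))) ∧
        (∀ T ∈ 𝔍 r, ∀ A B : X →L[ℝ] X, B.comp (T.comp A) ∈ 𝔍 r) ∧
        (∀ T ∈ 𝔍 r, FinStrictSing T)) ∧
      (∀ r s : ℝ, 0 < r → r < s → s < 1 →
        (𝔍 r : Set (X →L[ℝ] X)) ⊂ (𝔍 s : Set (X →L[ℝ] X))) := by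
  obtain ⟨P, Q, hPQ⟩ := hcompl
  obtain ⟨J, c, hc, hJ⟩ := exists_coord_op q (by linarith) hcopy
  have hp0 : 0 < p := by linarith
  have hq0 : 0 < q := by linarith
  set e0 := min (1 / 2) (1 - 1 / q) with he0
  have h1 : 1 - 1 / p < e0 := by
    rw [he0, lt_min_iff]
    constructor
    · have : 1 / 2 < 1 / p := by
        rw [div_lt_div_iff₀ (by norm_num) hp0]; linarith
      linarith
    · have : 1 / q < 1 / p := one_div_lt_one_div_of_lt hp0 hpq
      linarith
  set e : ℝ → ℝ := fun r => (1 - 1 / p) + r * (e0 - (1 - 1 / p)) with he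
  have hmono : ∀ r s, r < s → e r < e s := by
    intro r s hrs
    simp only [he]
    nlinarith
  refine ⟨fun r => idF X ⊓ idK X p (e r), fun r _ => ⟨?_, ?_, ?_⟩, fun r s hr hrs hs => ?_⟩
  · exact idF_closed.inter (idK_closed p (e r))
  · intro T hT A B
    exact ⟨Ctrl.comp hT.1 A B, SmallOn.comp hT.2 A B⟩
  · intro T hT
    exact Ctrl.fss hT.1
  · have hr1 : r < 1 := hrs.trans hs
    have e1 : 1 - 1 / p < e r := by simp only [he]; nlinarith
    have e2 : e r < e0 := by simp only [he]; nlinarith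
    obtain ⟨V, hV1, hV2, hV3⟩ := exists_V p q (e r) hp1 hp2 hpq P Q hPQ J c hc hJ e1
      (e2.trans_le (min_le_left _ _)) (e2.trans_le (min_le_right _ _))
    refine ⟨fun T hT => ⟨hT.1, SmallOn.mono hT.2 (hmono r s hrs).le⟩, fun hcon => ?_⟩
    have := hcon (show V ∈ (idF X ⊓ idK X p (e s) : Submodule ℝ (X →L[ℝ] X)) from
      ⟨hV1, hV2 _ (hmono r s hrs)⟩)
    exact hV3 this.2

end
end

section
/- Let 1 ≤ p < q < ∞ and let Y be a (real or complex) Banach space. If there exists an isomorphic embedding of ℓ_q into ℓ_p ⊕ Y (i.e. a bounded linear map J : ℓ_q → ℓ_p ⊕ Y and a constant c > 0 with ‖Jx‖ ≥ c‖x‖ for all x), then there exists an isomorphic embedding of ℓ_q into Y. -/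
open scoped ENNReal

noncomputable section

open Filter Topology in
lemma aux_count (a C r : ℝ) (ha : 0 < a) (hr : r < 1)
    (h : ∀ m : ℕ, (m : ℝ) * a ≤ C * (m : ℝ) ^ r) : False := by
  have h1 : Tendsto (fun m : ℕ => ((m : ℝ)) ^ (1 - r)) atTop atTop :=
    (tendsto_rpow_atTop (by linarith)).comp tendsto_natCast_atTop_atTop
  obtain ⟨m, hm, hm1⟩ := ((h1.eventually_gt_atTop (C / a)).and (eventually_ge_atTop 1)).exists
  have hmpos : (0 : ℝ) < m := by exact_mod_cast hm1
  have h2 := h m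
  have h3 : (m : ℝ) = (m : ℝ) ^ (1 - r) * (m : ℝ) ^ r := by
    rw [← Real.rpow_add hmpos]; simp
  have h4 : 0 < (m : ℝ) ^ r := Real.rpow_pos_of_pos hmpos r
  rw [div_lt_iff₀ ha] at hm
  have h5 : C * (m : ℝ) ^ r < (m : ℝ) ^ (1 - r) * a * (m : ℝ) ^ r :=
    mul_lt_mul_of_pos_right hm h4
  have h6 : (m : ℝ) * a = (m : ℝ) ^ (1 - r) * a * (m : ℝ) ^ r := by
    conv_lhs => rw [h3]
    ring
  linarith

lemma aux_bound {𝕜 : Type*} [RCLike 𝕜] {q : ℝ≥0∞} [Fact (1 ≤ q)] (hq : 0 < q.toReal)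
    {F : Type*} [NormedAddCommGroup F] [NormedSpace 𝕜 F]
    (g : lp (fun _ : ℕ => 𝕜) q →L[𝕜] F) (f : ℕ → 𝕜) (hf : ∀ i, ‖f i‖ ≤ 1) (s : Finset ℕ) :
    ‖g (∑ i ∈ s, lp.single q i (f i))‖ ≤ ‖g‖ * (s.card : ℝ) ^ (1 / q.toReal) := by
  refine (g.le_opNorm _).trans (mul_le_mul_of_nonneg_left ?_ (norm_nonneg _))
  have h1 := lp.norm_sum_single (E := fun _ : ℕ => 𝕜) hq f s
  have h2 : ∑ i ∈ s, ‖f i‖ ^ q.toReal ≤ s.card := by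
    have : ∑ i ∈ s, ‖f i‖ ^ q.toReal ≤ ∑ i ∈ s, (1 : ℝ) :=
      Finset.sum_le_sum fun i _ => Real.rpow_le_one (norm_nonneg _) (hf i) hq.le
    simpa using this
  rw [← h1] at h2
  have h3 := Real.rpow_le_rpow (by positivity) h2 (by positivity : 0 ≤ 1 / q.toReal)
  rwa [one_div, Real.rpow_rpow_inv (norm_nonneg _) hq.ne', ← one_div] at h3

open Filter Topology in
lemma aux_coord {𝕜 : Type*} [RCLike 𝕜] {q : ℝ≥0∞} [Fact (1 ≤ q)] (hq : 1 < q.toReal)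
    (g : lp (fun _ : ℕ => 𝕜) q →L[𝕜] 𝕜) :
    Tendsto (fun n => ‖g (lp.single q n (1 : 𝕜))‖) atTop (𝓝 0) := by
  rw [Metric.tendsto_atTop]
  by_contra hcon
  push Not at hcon
  obtain ⟨ε, hε, h⟩ := hcon
  have hinf : {n : ℕ | ε ≤ ‖g (lp.single q n (1 : 𝕜))‖}.Infinite := by
    rw [Set.infinite_iff_exists_gt]
    intro a
    obtain ⟨n, hn, hn2⟩ := h (a + 1)
    refine ⟨n, ?_, by omega⟩
    simpa using hn2
  apply aux_count ε ‖g‖ (1 / q.toReal) hε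
    (by rw [div_lt_one (by linarith)]; exact hq)
  intro m
  obtain ⟨s, hs, hcard⟩ := hinf.exists_subset_card_eq m
  let f : ℕ → 𝕜 := fun i =>
    (starRingEnd 𝕜) (g (lp.single q i (1 : 𝕜))) / (‖g (lp.single q i (1 : 𝕜))‖ : 𝕜)
  have hf : ∀ i, ‖f i‖ ≤ 1 := by
    intro i
    simp only [f, norm_div, RCLike.norm_conj, RCLike.norm_ofReal, abs_norm]
    exact div_self_le_one _
  have hb := aux_bound (by linarith) g f hf s
  rw [hcard] at hb
  refine le_trans ?_ hb
  have hterm : ∀ i, g (lp.single q i (f i)) = (‖g (lp.single q i (1 : 𝕜))‖ : 𝕜) := by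
    intro i
    have : lp.single q i (f i) = f i • (lp.single q i (1 : 𝕜) : lp (fun _ : ℕ => 𝕜) q) := by
      rw [← lp.single_smul]; simp
    rw [this, map_smul, smul_eq_mul]
    simp only [f]
    by_cases h0 : g (lp.single q i (1 : 𝕜)) = 0
    · simp [h0]
    · have h0' : (‖g (lp.single q i (1 : 𝕜))‖ : 𝕜) ≠ 0 := by
        simpa using h0
      rw [div_mul_eq_mul_div, RCLike.conj_mul, sq, mul_div_assoc, div_self h0', mul_one]
  rw [map_sum, Finset.sum_congr rfl fun i _ => hterm i, ← RCLike.ofReal_sum, RCLike.norm_ofReal]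
  refine le_trans ?_ (le_abs_self _)
  have := Finset.card_nsmul_le_sum s (fun i => ‖g (lp.single q i (1 : 𝕜))‖) ε
    (fun i hi => hs hi)
  rw [hcard] at this
  simpa using this

open Filter Topology in
lemma aux_BL {𝕜 : Type*} [RCLike 𝕜] {p : ℝ≥0∞} [Fact (1 ≤ p)] (hptop : p ≠ ⊤)
    (hp : 0 < p.toReal) (v : lp (fun _ : ℕ => 𝕜) p) (w : ℕ → lp (fun _ : ℕ => 𝕜) p)
    (hw : ∀ k, Tendsto (fun n => ‖w n k‖) atTop (𝓝 0)) (δ : ℝ) (hδ : 0 < δ) :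
    ∀ᶠ n in atTop, δ ≤ ‖w n‖ →
      ‖v‖ ^ p.toReal + δ ^ p.toReal / 2 ≤ ‖v + w n‖ ^ p.toReal := by
  set r := p.toReal with hr
  set A := ‖v‖ with hA
  have hA0 : 0 ≤ A := norm_nonneg _
  have hδr : 0 < δ ^ r := Real.rpow_pos_of_pos hδ r
  have hAr : 0 ≤ A ^ r := Real.rpow_nonneg hA0 r
  let G : ℝ → ℝ := fun t => ((max (A - t) 0) ^ r + (max (δ - t) 0) ^ r) ^ (1 / r) - 2 * t
  have hG : Continuous G := by
    have c1 : Continuous fun t : ℝ => (max (A - t) 0) ^ r :=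
      (by fun_prop : Continuous fun t : ℝ => max (A - t) 0).rpow_const fun _ => Or.inr hp.le
    have c2 : Continuous fun t : ℝ => (max (δ - t) 0) ^ r :=
      (by fun_prop : Continuous fun t : ℝ => max (δ - t) 0).rpow_const fun _ => Or.inr hp.le
    exact ((c1.add c2).rpow_const fun _ => Or.inr (by positivity)).sub (by fun_prop)
  have hG0 : (A ^ r + δ ^ r / 2) ^ (1 / r) < G 0 := by
    simp only [G, sub_zero, mul_zero, max_eq_left hA0, max_eq_left hδ.le]
    exact Real.rpow_lt_rpow (by positivity) (by linarith) (by positivity)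
  have hev : ∀ᶠ t in 𝓝[>] (0 : ℝ), (A ^ r + δ ^ r / 2) ^ (1 / r) < G t :=
    ((hG.tendsto 0).eventually_const_lt hG0).filter_mono nhdsWithin_le_nhds
  obtain ⟨t, htG, ht⟩ := (hev.and self_mem_nhdsWithin).exists
  have ht : 0 < t := ht
  obtain ⟨s, hs⟩ := (Metric.tendsto_nhds.1 (lp.hasSum_single hptop v) t ht).exists
  set v' : lp (fun _ : ℕ => 𝕜) p := ∑ i ∈ s, lp.single p i (v i) with hv'
  rw [dist_eq_norm] at hs
  have hwsum : Tendsto (fun n => ∑ i ∈ s, ‖w n i‖) atTop (𝓝 0) := by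
    simpa using tendsto_finsetSum s fun i _ => hw i
  filter_upwards [hwsum.eventually_lt_const ht] with n hn hδn
  set w' : lp (fun _ : ℕ => 𝕜) p := ∑ i ∈ s, lp.single p i (w n i) with hw'
  have hp0 : 0 < p := zero_lt_one.trans_le Fact.out
  have hw't : ‖w'‖ < t := by
    refine lt_of_le_of_lt ((norm_sum_le _ _).trans (Finset.sum_le_sum fun i _ => ?_)) hn
    rw [lp.norm_single hp0]
  have hf : ∀ i ∈ s, (v' + (w n - w')) i = v i := by
    intro i hi
    have hx : ∀ x : ℕ → 𝕜,
        (∑ j ∈ s, (lp.single p j (x j) : lp (fun _ : ℕ => 𝕜) p)) i = x i := by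
      intro x
      rw [lp.coeFn_sum, Finset.sum_apply]
      simp only [lp.coeFn_single]
      rw [Finset.sum_pi_single, if_pos hi]
    change v' i + (w n i - w' i) = v i
    rw [hv', hw', hx, hx, sub_self, add_zero]
  have key : ‖v' + (w n - w')‖ ^ r = ‖v'‖ ^ r + ‖w n - w'‖ ^ r := by
    have h1 := lp.norm_compl_sum_single hp (v' + (w n - w')) s
    have h2 : ∑ i ∈ s, lp.single p i ((v' + (w n - w')) i) = v' :=
      Finset.sum_congr rfl fun i hi => by rw [hf i hi]
    have h3 : ∑ i ∈ s, ‖(v' + (w n - w')) i‖ ^ p.toReal = ‖v'‖ ^ p.toReal := by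
      rw [hv', lp.norm_sum_single hp]
      exact Finset.sum_congr rfl fun i hi => by rw [← hv', hf i hi]
    rw [h2, h3, add_sub_cancel_left] at h1
    rw [hr]; linarith
  have e1 : A - t ≤ ‖v'‖ := by
    have := norm_sub_norm_le v v'
    rw [norm_sub_rev] at this
    linarith
  have e2 : δ - t ≤ ‖w n - w'‖ := by
    have := norm_sub_norm_le (w n) w'
    linarith
  have e3 : ((max (A - t) 0) ^ r + (max (δ - t) 0) ^ r) ^ (1 / r) ≤ ‖v' + (w n - w')‖ := by
    have h1 : (max (A - t) 0) ^ r + (max (δ - t) 0) ^ r ≤ ‖v' + (w n - w')‖ ^ r := by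
      rw [key]
      exact add_le_add
        (Real.rpow_le_rpow (le_max_right _ _) (max_le e1 (norm_nonneg _)) hp.le)
        (Real.rpow_le_rpow (le_max_right _ _) (max_le e2 (norm_nonneg _)) hp.le)
    have h3 := Real.rpow_le_rpow (by positivity) h1 (by positivity : 0 ≤ 1 / r)
    rwa [one_div, Real.rpow_rpow_inv (norm_nonneg _) hp.ne', ← one_div] at h3
  have e4 : ‖v' + (w n - w')‖ ≤ ‖v + w n‖ + 2 * t := by
    have : v' + (w n - w') = (v + w n) + (v' - v) - w' := by abel
    rw [this]
    have h1 := norm_sub_le ((v + w n) + (v' - v)) w'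
    have h2 := norm_add_le (v + w n) (v' - v)
    linarith
  have e5 : (A ^ r + δ ^ r / 2) ^ (1 / r) ≤ ‖v + w n‖ := by
    simp only [G] at htG
    linarith
  have h3 := Real.rpow_le_rpow (by positivity) e5 hp.le
  rwa [one_div, Real.rpow_inv_rpow (by positivity) hp.ne'] at h3

open Filter Topology in
/-- Weak form of the Pitt theorem: the unit vectors are sent to a null sequence. -/
lemma aux_pitt {𝕜 : Type*} [RCLike 𝕜] {p q : ℝ≥0∞} [Fact (1 ≤ p)] [Fact (1 ≤ q)]
    (hptop : p ≠ ⊤) (hp : 1 ≤ p.toReal) (hpq : p.toReal < q.toReal)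
    (T : lp (fun _ : ℕ => 𝕜) q →L[𝕜] lp (fun _ : ℕ => 𝕜) p) (δ : ℝ) (hδ : 0 < δ) (N : ℕ) :
    ∃ n, N ≤ n ∧ ‖T (lp.single q n (1 : 𝕜))‖ < δ := by
  by_contra hcon
  push Not at hcon
  have hp0 : 0 < p.toReal := by linarith
  have hq0 : 0 < q.toReal := by linarith
  have hw : ∀ k, Tendsto (fun n => ‖T (lp.single q n (1 : 𝕜)) k‖) atTop (𝓝 0) := by
    intro k
    let e : lp (fun _ : ℕ => 𝕜) p →L[𝕜] 𝕜 :=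
      LinearMap.mkContinuous
        { toFun := fun x => x k
          map_add' := fun _ _ => rfl
          map_smul' := fun _ _ => rfl } 1
        (fun x => by
          rw [one_mul]
          exact lp.norm_apply_le_norm (zero_lt_one.trans_le Fact.out).ne' x k)
    exact aux_coord (by linarith) (e.comp T)
  have hind : ∀ m : ℕ, ∃ s : Finset ℕ, s.card = m ∧
      (m : ℝ) * (δ ^ p.toReal / 2) ≤
        ‖T (∑ i ∈ s, lp.single q i (1 : 𝕜))‖ ^ p.toReal := by
    intro m
    induction m with
    | zero => exact ⟨∅, rfl, by simp; positivity⟩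
    | succ m ih =>
      obtain ⟨s, hs, hsm⟩ := ih
      obtain ⟨n, hn, hnN, hns⟩ :=
        ((aux_BL hptop hp0 (T (∑ i ∈ s, lp.single q i (1 : 𝕜)))
          (fun n => T (lp.single q n (1 : 𝕜))) hw δ hδ).and
          ((eventually_ge_atTop N).and (eventually_gt_atTop (s.sup id)))).exists
      have hnotin : n ∉ s := fun h => by
        have := Finset.le_sup (f := id) h
        simp only [id] at this hns
        exact absurd hns (not_lt.2 this)
      refine ⟨insert n s, by rw [Finset.card_insert_of_notMem hnotin, hs], ?_⟩
      have h1 := hn (hcon n hnN)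
      rw [Finset.sum_insert hnotin, map_add, add_comm (T _)]
      push_cast
      linarith
  apply aux_count (δ ^ p.toReal / 2) (‖T‖ ^ p.toReal) (p.toReal / q.toReal)
    (by positivity) (by rwa [div_lt_one hq0])
  intro m
  obtain ⟨s, hs, hsm⟩ := hind m
  refine hsm.trans ?_
  have hb := aux_bound hq0 T (fun _ => (1 : 𝕜)) (by simp) s
  rw [hs] at hb
  have h3 := Real.rpow_le_rpow (norm_nonneg _) hb hp0.le
  rwa [Real.mul_rpow (norm_nonneg _) (by positivity), ← Real.rpow_mul (by positivity),
    one_div_mul_eq_div] at h3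

lemma aux_embed {𝕜 : Type*} [RCLike 𝕜] {q : ℝ≥0∞} [Fact (1 ≤ q)] (hq : 0 < q.toReal)
    (φ : ℕ → ℕ) (hφ : Function.Injective φ) :
    ∃ U : lp (fun _ : ℕ => 𝕜) q →L[𝕜] lp (fun _ : ℕ => 𝕜) q,
      (∀ x, ‖U x‖ = ‖x‖) ∧ ∀ n a, U (lp.single q n a) = lp.single q (φ n) a := by
  have hcomp : ∀ x : ℕ → 𝕜, (fun i => ‖Function.extend φ x 0 i‖ ^ q.toReal) ∘ φ
      = fun i => ‖x i‖ ^ q.toReal := by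
    intro x; ext i; simp [hφ.extend_apply]
  have hzero : ∀ x : ℕ → 𝕜, ∀ i, i ∉ Set.range φ →
      ‖Function.extend φ x 0 i‖ ^ q.toReal = 0 := by
    intro x i hi
    rw [Function.extend_apply' _ _ _ (by simpa using hi)]
    simp [Real.zero_rpow hq.ne']
  have hmem : ∀ x : lp (fun _ : ℕ => 𝕜) q,
      Memℓp (E := fun _ : ℕ => 𝕜) (Function.extend φ (x : ℕ → 𝕜) 0) q := by
    intro x
    apply memℓp_gen
    rw [← hφ.summable_iff (hzero x), hcomp]
    exact (lp.memℓp x).summable hq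
  let L : lp (fun _ : ℕ => 𝕜) q →ₗ[𝕜] lp (fun _ : ℕ => 𝕜) q :=
    { toFun := fun x => ⟨Function.extend φ (x : ℕ → 𝕜) 0, hmem x⟩
      map_add' := fun x y => by
        ext i
        by_cases hi : ∃ a, φ a = i
        · obtain ⟨a, rfl⟩ := hi
          change Function.extend φ ((x : ℕ → 𝕜) + (y : ℕ → 𝕜)) 0 (φ a)
            = Function.extend φ (x : ℕ → 𝕜) 0 (φ a) + Function.extend φ (y : ℕ → 𝕜) 0 (φ a)
          simp only [hφ.extend_apply, Pi.add_apply]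
        · change Function.extend φ ((x : ℕ → 𝕜) + (y : ℕ → 𝕜)) 0 i
            = Function.extend φ (x : ℕ → 𝕜) 0 i + Function.extend φ (y : ℕ → 𝕜) 0 i
          simp [Function.extend_apply' _ _ _ hi]
      map_smul' := fun c x => by
        ext i
        by_cases hi : ∃ a, φ a = i
        · obtain ⟨a, rfl⟩ := hi
          simp [hφ.extend_apply]
        · simp [Function.extend_apply' _ _ _ hi] }
  have hL : ∀ x, ‖L x‖ = ‖x‖ := by
    intro x
    rw [lp.norm_eq_tsum_rpow hq, lp.norm_eq_tsum_rpow hq]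
    congr 1
    have h1 := hφ.tsum_eq (f := fun i => ‖Function.extend φ (x : ℕ → 𝕜) 0 i‖ ^ q.toReal)
      (fun i hi => by
        by_contra h
        exact hi (hzero x i h))
    rw [show (∑' i, ‖(L x) i‖ ^ q.toReal)
      = ∑' i, ‖Function.extend φ (x : ℕ → 𝕜) 0 i‖ ^ q.toReal from rfl, ← h1]
    exact congrArg tsum (hcomp x)
  refine ⟨L.mkContinuous 1 fun x => by rw [hL, one_mul], hL, ?_⟩
  intro n a
  ext i
  change Function.extend φ (Pi.single n a : ℕ → 𝕜) 0 i = (Pi.single (φ n) a : ℕ → 𝕜) i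
  by_cases hi : ∃ b, φ b = i
  · obtain ⟨b, rfl⟩ := hi
    rw [hφ.extend_apply]
    simp [Pi.single_apply, hφ.eq_iff]
  · rw [Function.extend_apply' _ _ _ hi, Pi.single_eq_of_ne (fun h => hi ⟨n, h.symm⟩)]
    rfl

/-- if `1 ≤ p < q < ∞` and `ℓ_q` embeds isomorphically into `ℓ_p ⊕₁ Y`,
then `ℓ_q` embeds isomorphically into `Y`. -/
theorem statement6 (𝕜 : Type*) [RCLike 𝕜] (p q : ℝ) (hp : 1 ≤ p) (hpq : p < q)
    [Fact (1 ≤ ENNReal.ofReal p)] [Fact (1 ≤ ENNReal.ofReal q)]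
    (Y : Type*) [NormedAddCommGroup Y] [NormedSpace 𝕜 Y] [CompleteSpace Y]
    (hembed : ∃ (J : lp (fun _ : ℕ => 𝕜) (ENNReal.ofReal q) →L[𝕜]
        WithLp 1 ((lp (fun _ : ℕ => 𝕜) (ENNReal.ofReal p)) × Y)) (c : ℝ),
      0 < c ∧ ∀ x, c * ‖x‖ ≤ ‖J x‖) :
    ∃ (J' : lp (fun _ : ℕ => 𝕜) (ENNReal.ofReal q) →L[𝕜] Y) (c' : ℝ),
      0 < c' ∧ ∀ x, c' * ‖x‖ ≤ ‖J' x‖ := by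
  obtain ⟨J, c, hc, hJ⟩ := hembed
  have hpr : (ENNReal.ofReal p).toReal = p := ENNReal.toReal_ofReal (by linarith)
  have hqr : (ENNReal.ofReal q).toReal = q := ENNReal.toReal_ofReal (by linarith)
  let T : lp (fun _ : ℕ => 𝕜) (ENNReal.ofReal q) →L[𝕜] lp (fun _ : ℕ => 𝕜) (ENNReal.ofReal p) :=
    (WithLp.fstL 1 𝕜 _ _).comp J
  let S : lp (fun _ : ℕ => 𝕜) (ENNReal.ofReal q) →L[𝕜] Y := (WithLp.sndL 1 𝕜 _ _).comp J
  have hTS : ∀ x, c * ‖x‖ ≤ ‖T x‖ + ‖S x‖ := fun x => by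
    have := hJ x
    rwa [WithLp.prod_norm_eq_of_L1] at this
  have hpitt := aux_pitt (𝕜 := 𝕜) ENNReal.ofReal_ne_top (by rwa [hpr]) (by rwa [hpr, hqr]) T
  have hex : ∃ φ : ℕ → ℕ, StrictMono φ ∧
      ∀ n, ‖T (lp.single _ (φ n) (1 : 𝕜))‖ < (c / 2) / 2 / 2 ^ n := by
    apply Filter.extraction_forall_of_frequently
      (P := fun n k => ‖T (lp.single _ k (1 : 𝕜))‖ < (c / 2) / 2 / 2 ^ n)
    intro n
    rw [Filter.frequently_atTop]
    intro N
    exact hpitt _ (by positivity) N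
  obtain ⟨φ, hφ, hφT⟩ := hex
  obtain ⟨U, hU, hUs⟩ := aux_embed (𝕜 := 𝕜) (q := ENNReal.ofReal q)
    (by rw [hqr]; linarith) φ hφ.injective
  refine ⟨S.comp U, c / 2, by positivity, fun x => ?_⟩
  have hTU : ‖T (U x)‖ ≤ c / 2 * ‖x‖ := by
    have hs := (lp.hasSum_single ENNReal.ofReal_ne_top x).mapL (T.comp U)
    have hb : HasSum (fun n : ℕ => (c / 2) / 2 / 2 ^ n * ‖x‖) (c / 2 * ‖x‖) :=
      (hasSum_geometric_two' (c / 2)).mul_right _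
    rw [show T (U x) = (T.comp U) x from rfl, ← hs.tsum_eq]
    refine tsum_of_norm_bounded hb fun n => ?_
    have h1 : (T.comp U) (lp.single _ n (x n)) = x n • T (lp.single _ (φ n) (1 : 𝕜)) := by
      rw [ContinuousLinearMap.comp_apply, hUs, ← map_smul, ← lp.single_smul]
      simp
    rw [h1, norm_smul, mul_comm]
    exact mul_le_mul (hφT n).le
      (lp.norm_apply_le_norm (zero_lt_one.trans_le Fact.out).ne' x n) (norm_nonneg _)
      (by positivity)
  have h1 := hTS (U x)
  rw [hU] at h1
  change c / 2 * ‖x‖ ≤ ‖S (U x)‖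
  linarith

end
end
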